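/- For every prime p there exists an abelian p-group G of length ω+1 (i.e., with p·(⋂ₙ pⁿG) = 0 and ⋂ₙ pⁿG ≠ 0) that has minimal characteristic inertia but does not have minimal full inertia. -/

import Mathlib

section Defs

variable {G : Type*} [AddCommGroup G]

/-- For a subgroup `X` of `G` and an endomorphism `φ` of `G`, `hatImage X φ` is the image
of `φ(X)` in the quotient `G ⧸ X`, i.e. the subgroup `(φ(X) + X)/X`. -/
def hatImage (X : AddSubgroup G) (φ : G →+ G) : AddSubgroup (G ⧸ X) :=
  (AddSubgroup.map φ X).map (QuotientAddGroup.mk' X)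

/-- `X` is fully invariant: stable under every additive endomorphism of `G`. -/
def FullyInvariantSub (X : AddSubgroup G) : Prop :=
  ∀ φ : G →+ G, AddSubgroup.map φ X ≤ X

/-- `X` is characteristic: stable under every additive automorphism of `G`. -/
def CharacteristicSub (X : AddSubgroup G) : Prop :=
  ∀ φ : G ≃+ G, AddSubgroup.map φ.toAddMonoidHom X ≤ X

/-- `X` is fully inert: `φ̂(X)` is finite for every endomorphism `φ` of `G`. -/
def FullyInertSub (X : AddSubgroup G) : Prop :=
  ∀ φ : G →+ G, Finite (hatImage X φ)

/-- `X` is characteristically inert: `φ̂(X)` is finite for every automorphism `φ` of `G`. -/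
def CharInertSub (X : AddSubgroup G) : Prop :=
  ∀ φ : G ≃+ G, Finite (hatImage X φ.toAddMonoidHom)

/-- Two subgroups are commensurable if their intersection has finite index in each of them. -/
def Commens (X Y : AddSubgroup G) : Prop :=
  ((X ⊓ Y).addSubgroupOf X).index ≠ 0 ∧ ((X ⊓ Y).addSubgroupOf Y).index ≠ 0

/-- `G` has minimal full inertia: every fully inert subgroup is commensurable with a
fully invariant subgroup. -/
def MinFullInertia (G : Type*) [AddCommGroup G] : Prop :=
  ∀ X : AddSubgroup G, FullyInertSub X → ∃ Y : AddSubgroup G, FullyInvariantSub Y ∧ Commens X Y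

/-- `G` has minimal characteristic inertia: every characteristically inert subgroup is
commensurable with a characteristic subgroup. -/
def MinCharInertia (G : Type*) [AddCommGroup G] : Prop :=
  ∀ X : AddSubgroup G, CharInertSub X → ∃ Y : AddSubgroup G, CharacteristicSub Y ∧ Commens X Y

/-- `G` is a `p`-group: every element is killed by some power of `p`. -/
def IsPGroup' (p : ℕ) (G : Type*) [AddCommGroup G] : Prop :=
  ∀ x : G, ∃ n : ℕ, p ^ n • x = 0

/-- Multiplication by `m` as an additive endomorphism of `G`. -/
def smulHom (m : ℕ) : G →+ G where
  toFun x := m • x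
  map_zero' := smul_zero m
  map_add' a b := smul_add m a b

/-- The subgroup `pⁿG`. -/
def pPowSub (p n : ℕ) : AddSubgroup G :=
  AddSubgroup.map (smulHom (p ^ n)) ⊤

/-- The subgroup `B[m] = {x ∈ B : m • x = 0}`. -/
def torSub (m : ℕ) (B : AddSubgroup G) : AddSubgroup G :=
  B ⊓ (smulHom m).ker

/-- The subgroup `mB = {m • x : x ∈ B}`. -/
def smulSub (m : ℕ) (B : AddSubgroup G) : AddSubgroup G :=
  AddSubgroup.map (smulHom m) B

/-- The `p`-height of `x` in `G`: the supremum in `ℕ∞` of the set of `n` with `x ∈ pⁿG`. -/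
noncomputable def pHeight (p : ℕ) (x : G) : ℕ∞ :=
  ⨆ n ∈ {n : ℕ | x ∈ (pPowSub p n : AddSubgroup G)}, (n : ℕ∞)

/-- `G` is transitive: any two elements with identical height sequences are connected by
an automorphism. -/
def TransitiveP (p : ℕ) (G : Type*) [AddCommGroup G] : Prop :=
  ∀ x y : G, (∀ n : ℕ, pHeight p (p ^ n • x) = pHeight p (p ^ n • y)) →
    ∃ φ : G ≃+ G, φ x = y

/-- `G` is separable: `p^ω G = ⋂ₙ pⁿG = 0`. -/
def SeparableP (p : ℕ) (G : Type*) [AddCommGroup G] : Prop :=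
  (⨅ n : ℕ, (pPowSub p n : AddSubgroup G)) = ⊥

end Defs

section PartOne

open AddSubgroup
open scoped Pointwise

variable {G : Type*} [AddCommGroup G]

/-- `Y` is contained in `X` up to a finite subgroup. -/
def ALE (Y X : AddSubgroup G) : Prop :=
  ∃ F : AddSubgroup G, Finite F ∧ Y ≤ X ⊔ F

lemma finite_sup_aux (F F' : AddSubgroup G) (h : Finite F) (h' : Finite F') :
    Finite ↥(F ⊔ F') := by
  have : (((F ⊔ F' : AddSubgroup G)) : Set G) = (F : Set G) + (F' : Set G) := by
    exact AddSubgroup.add_normal F F'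
  have h2 : (((F ⊔ F' : AddSubgroup G)) : Set G).Finite := by
    rw [this]
    exact Set.Finite.add (Set.toFinite _) (Set.toFinite _)
  exact h2

lemma finite_map_aux {G' : Type*} [AddCommGroup G'] (φ : G →+ G') (F : AddSubgroup G)
    (h : Finite F) : Finite ↥(F.map φ) := by
  have h2 : ((F.map φ : AddSubgroup G') : Set G').Finite := by
    rw [AddSubgroup.coe_map]
    exact Set.Finite.image _ (Set.toFinite _)
  exact h2

lemma ALE.of_le {Y X : AddSubgroup G} (h : Y ≤ X) : ALE Y X :=
  ⟨⊥, inferInstance, h.trans le_sup_left⟩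

lemma ALE.trans {Z Y X : AddSubgroup G} (h : ALE Z Y) (h' : ALE Y X) : ALE Z X := by
  obtain ⟨F, hF, h⟩ := h
  obtain ⟨F', hF', h'⟩ := h'
  refine ⟨F' ⊔ F, finite_sup_aux _ _ hF' hF, h.trans ?_⟩
  rw [← sup_assoc]
  exact sup_le_sup_right h' _

lemma ALE.sup {Z Y X : AddSubgroup G} (h : ALE Z X) (h' : ALE Y X) : ALE (Z ⊔ Y) X := by
  obtain ⟨F, hF, h⟩ := h
  obtain ⟨F', hF', h'⟩ := h'
  refine ⟨F ⊔ F', finite_sup_aux _ _ hF hF', sup_le (h.trans ?_) (h'.trans ?_)⟩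
  · exact sup_le_sup_left le_sup_left _
  · exact sup_le_sup_left le_sup_right _

lemma ALE.map {G' : Type*} [AddCommGroup G'] (φ : G →+ G') {Y X : AddSubgroup G}
    (h : ALE Y X) : ALE (Y.map φ) (X.map φ) := by
  obtain ⟨F, hF, h⟩ := h
  refine ⟨F.map φ, finite_map_aux _ _ hF, ?_⟩
  rw [← AddSubgroup.map_sup]
  exact AddSubgroup.map_mono h

lemma ALE.relIndex_ne_zero {Y X : AddSubgroup G} (h : ALE Y X) : X.relIndex Y ≠ 0 := by
  obtain ⟨F, hF, h⟩ := h
  have h1 : X.relIndex (X ⊔ F) ≠ 0 := by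
    rw [AddSubgroup.relIndex_sup_left]
    intro h0
    have := AddSubgroup.relIndex_dvd_card X F
    rw [h0] at this
    have h3 : Nat.card F = 0 := Nat.eq_zero_of_zero_dvd this
    exact (Nat.card_pos (α := F)).ne' h3
  intro h0
  exact h1 (AddSubgroup.relIndex_eq_zero_of_le_right h h0)

lemma finite_closure_aux {p : ℕ} (hp : p.Prime) (hG : IsPGroup' p G) (s : Set G)
    (hs : s.Finite) : Finite ↥(AddSubgroup.closure s) := by
  induction s, hs using Set.Finite.induction_on with
  | empty => rw [AddSubgroup.closure_empty]; infer_instance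
  | @insert a s ha hs ih =>
    rw [Set.insert_eq, AddSubgroup.closure_union]
    refine finite_sup_aux _ _ ?_ ih
    rw [← AddSubgroup.zmultiples_eq_closure]
    apply Set.finite_coe_iff.mpr
    rw [finite_zmultiples]
    obtain ⟨n, hn⟩ := hG a
    exact isOfFinAddOrder_iff_nsmul_eq_zero.mpr ⟨p ^ n, pow_pos hp.pos n, hn⟩

lemma ALE.of_relIndex {p : ℕ} (hp : p.Prime) (hG : IsPGroup' p G) {Y X : AddSubgroup G}
    (h : X.relIndex Y ≠ 0) : ALE Y (Y ⊓ X) := by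
  have hfin : Finite (Y ⧸ (X.addSubgroupOf Y)) :=
    @AddSubgroup.finite_quotient_of_finiteIndex _ _ (X.addSubgroupOf Y) ⟨h⟩
  let s : Set G := Set.range (fun q : Y ⧸ (X.addSubgroupOf Y) => ((Quotient.out q : Y) : G))
  have hs : s.Finite := Set.finite_range _
  refine ⟨AddSubgroup.closure s, finite_closure_aux hp hG s hs, ?_⟩
  intro y hy
  let q : Y ⧸ (X.addSubgroupOf Y) := QuotientAddGroup.mk ⟨y, hy⟩
  have h1 : ((Quotient.out q : Y) : G) ∈ AddSubgroup.closure s :=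
    AddSubgroup.subset_closure ⟨q, rfl⟩
  have h2 : QuotientAddGroup.mk (Quotient.out q) = q := QuotientAddGroup.out_eq' q
  have h3 : (-(Quotient.out q) + ⟨y, hy⟩ : Y) ∈ X.addSubgroupOf Y := by
    rw [← QuotientAddGroup.eq]
    exact h2
  rw [AddSubgroup.mem_addSubgroupOf] at h3
  have h4 : y = (-((Quotient.out q : Y) : G) + y) + ((Quotient.out q : Y) : G) := by abel
  rw [h4]
  refine AddSubgroup.add_mem_sup ⟨?_, ?_⟩ h1
  · exact Y.add_mem (Y.neg_mem (Quotient.out q).2) hy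
  · simpa using h3

lemma ALE.of_hatImage {p : ℕ} (hp : p.Prime) (hG : IsPGroup' p G) {X : AddSubgroup G}
    {φ : G →+ G} (h : Finite (hatImage X φ)) : ALE (X.map φ) X := by
  have : X.relIndex (X.map φ) ≠ 0 := by
    have e : ((QuotientAddGroup.mk' X).ker).relIndex (X.map φ) = Nat.card (hatImage X φ) := by
      rw [AddSubgroup.relIndex_ker]
      rfl
    rw [QuotientAddGroup.ker_mk'] at e
    rw [e]
    exact (Nat.card_pos).ne'
  exact (ALE.of_relIndex hp hG this).trans (ALE.of_le inf_le_right)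

lemma ALE.finite_hat {X : AddSubgroup G}
    {φ : G →+ G} (h : ALE (X.map φ) X) : Finite (_root_.hatImage X φ) := by
  obtain ⟨F, hF, h⟩ := h
  have : Finite ↥(F.map (QuotientAddGroup.mk' X)) := finite_map_aux _ _ hF
  have hle : _root_.hatImage X φ ≤ F.map (QuotientAddGroup.mk' X) := by
    refine (AddSubgroup.map_mono h).trans ?_
    rw [AddSubgroup.map_sup]
    refine sup_le ?_ le_rfl
    rw [QuotientAddGroup.map_mk'_self]
    exact bot_le
  exact Finite.of_injective _ (AddSubgroup.inclusion_injective hle)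

lemma commens_iff {X Y : AddSubgroup G} : Commens X Y ↔ Y.relIndex X ≠ 0 ∧ X.relIndex Y ≠ 0 := by
  have h1 : ((X ⊓ Y).addSubgroupOf X).index = (X ⊓ Y).relIndex X := rfl
  have h2 : ((X ⊓ Y).addSubgroupOf Y).index = (X ⊓ Y).relIndex Y := rfl
  unfold Commens
  rw [h1, h2, AddSubgroup.inf_relIndex_left, AddSubgroup.inf_relIndex_right]

lemma ALE.commens {X Y : AddSubgroup G} (h : ALE X Y) (h' : ALE Y X) : Commens X Y :=
  commens_iff.mpr ⟨h.relIndex_ne_zero, h'.relIndex_ne_zero⟩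

lemma ALE.comap {p : ℕ} (hp : p.Prime) (hG : IsPGroup' p G) {G' : Type*} [AddCommGroup G']
    (φ : G →+ G') {Y : AddSubgroup G} {X : AddSubgroup G'} (h : ALE (Y.map φ) X) :
    ALE Y (Y ⊓ X.comap φ) := by
  apply ALE.of_relIndex hp hG
  rw [AddSubgroup.relIndex_comap]
  exact h.relIndex_ne_zero

/-- pigeonhole: an infinite greedy sequence contradicts being almost contained. -/
lemma ALE.greedy {Y X : AddSubgroup G} (h : ALE Y X) (x : ℕ → G) (hx : ∀ i, x i ∈ Y)
    (F : ℕ → AddSubgroup G) (hF : ∀ i j, i < j → x i ∈ F j)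
    (hn : ∀ i, x i ∉ X ⊔ F i) : False := by
  obtain ⟨E, hE, h⟩ := h
  have h1 : ∀ i, ∃ e : E, x i - e ∈ X := by
    intro i
    obtain ⟨y, hy, z, hz, hyz⟩ := AddSubgroup.mem_sup.mp (h (hx i))
    exact ⟨⟨z, hz⟩, by rw [← hyz]; simpa using hy⟩
  choose e he using h1
  obtain ⟨i, j, hij, hee⟩ := Finite.exists_ne_map_eq_of_infinite e
  wlog hlt : i < j generalizing i j
  · exact this j i hij.symm hee.symm (lt_of_le_of_ne (not_lt.mp hlt) hij.symm)
  apply hn j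
  have h2 : x j = (x j - e j - (x i - e i)) + x i := by rw [hee]; abel
  rw [h2]
  exact AddSubgroup.add_mem_sup (X.sub_mem (he j) (he i)) (hF i j hlt)

end PartOne

section PartTwo

open AddSubgroup

lemma mem_pPow {G : Type*} [AddCommGroup G] {p n : ℕ} {x : G} :
    x ∈ (pPowSub p n : AddSubgroup G) ↔ ∃ y : G, p ^ n • y = x := by
  unfold pPowSub
  rw [AddSubgroup.mem_map]
  constructor
  · rintro ⟨y, -, h⟩; exact ⟨y, h⟩
  · rintro ⟨y, h⟩; exact ⟨y, trivial, h⟩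

/-- the first Ulm subgroup -/
def ulm (p : ℕ) (G : Type*) [AddCommGroup G] : AddSubgroup G := ⨅ n : ℕ, pPowSub p n

lemma mem_ulm {G : Type*} [AddCommGroup G] {p : ℕ} {x : G} :
    x ∈ ulm p G ↔ ∀ n, ∃ y : G, p ^ n • y = x := by
  unfold ulm
  rw [AddSubgroup.mem_iInf]
  simp only [mem_pPow]

lemma ulm_map {G K : Type*} [AddCommGroup G] [AddCommGroup K] {p : ℕ} {x : G} (φ : G →+ K)
    (hx : x ∈ ulm p G) : φ x ∈ ulm p K := by
  rw [mem_ulm] at *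
  intro n
  obtain ⟨y, rfl⟩ := hx n
  exact ⟨φ y, (map_nsmul φ _ _).symm⟩

lemma zmod_hom {K : Type*} [AddCommGroup K] (m : ℕ) (g : K) (hg : m • g = 0) :
    ∃ ψ : ZMod m →+ K, ψ 1 = g := by
  refine ⟨ZMod.lift m ⟨zmultiplesHom K g, ?_⟩, ?_⟩
  · simpa using hg
  · have := ZMod.lift_coe m ⟨zmultiplesHom K g, by simpa using hg⟩ 1
    simpa using this

lemma zmod_mult {p : ℕ} (hp : p.Prime) (h k : ℕ) (hk : k ≤ h) (t : ZMod (p ^ (h + 1)))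
    (ht : p ^ k • t ≠ 0) : ∃ m : ℤ, m • t = p ^ (h - k) • (1 : ZMod (p ^ (h + 1))) := by
  have : NeZero (p ^ (h + 1)) := ⟨(pow_pos hp.pos _).ne'⟩
  obtain ⟨j, hj, hg⟩ := (Nat.dvd_prime_pow hp).1 (Nat.gcd_dvd_right t.val (p ^ (h + 1)))
  have htv : ((t.val : ℕ) : ZMod (p ^ (h + 1))) = t := ZMod.natCast_zmod_val t
  have hjk : j ≤ h - k := by
    by_contra hlt
    push Not at hlt
    apply ht
    have h1 : p ^ (h - k + 1) ∣ t.val := by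
      refine (pow_dvd_pow p hlt).trans ?_
      rw [← hg]; exact Nat.gcd_dvd_left _ _
    obtain ⟨c, hc⟩ := h1
    rw [← htv, hc, nsmul_eq_mul]
    have : p ^ k * (p ^ (h - k + 1) * c) = p ^ (h + 1) * c := by
      rw [← mul_assoc, ← pow_add]; congr 2; omega
    rw [← Nat.cast_mul, this]
    push_cast
    have h0 : ((p ^ (h + 1) : ℕ) : ZMod (p ^ (h + 1))) = 0 := ZMod.natCast_self _
    push_cast at h0
    rw [h0, zero_mul]
  have hb := Nat.gcd_eq_gcd_ab t.val (p ^ (h + 1))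
  rw [hg] at hb
  have hb2 := congrArg (Int.cast : ℤ → ZMod (p ^ (h + 1))) hb
  have h0 : ((p ^ (h + 1) : ℕ) : ZMod (p ^ (h + 1))) = 0 := ZMod.natCast_self _
  push_cast at hb2 h0
  rw [h0, zero_mul, add_zero, htv] at hb2
  refine ⟨(p ^ (h - k - j) : ℕ) * Nat.gcdA t.val (p ^ (h + 1)), ?_⟩
  rw [zsmul_eq_mul, nsmul_eq_mul, mul_one]
  push_cast
  have : (p : ZMod (p ^ (h + 1))) ^ (h - k) = p ^ (h - k - j) * p ^ j := by
    rw [← pow_add]; congr 1; omega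
  rw [this, hb2]
  ring

lemma zmod_circle {p : ℕ} (hp : p.Prime) (n : ℕ) :
    ∃ i : ZMod (p ^ n) →+ AddCircle (1 : ℚ), Function.Injective i ∧
      ∀ c : AddCircle (1 : ℚ), p ^ n • c = 0 → c ∈ i.range := by
  have hpos : 0 < p ^ n := pow_pos hp.pos _
  have : NeZero (p ^ n) := ⟨hpos.ne'⟩
  have hq : ((p ^ n : ℕ) : ℚ) ≠ 0 := by exact_mod_cast hpos.ne'
  have h0 : p ^ n • (((1 / (p ^ n : ℕ) : ℚ)) : AddCircle (1 : ℚ)) = 0 := by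
    rw [← AddCircle.coe_nsmul, nsmul_eq_mul, mul_one_div_cancel hq]
    exact AddCircle.coe_period 1
  obtain ⟨i, hi⟩ := zmod_hom (p ^ n) _ h0
  have hi2 : ∀ m : ℕ, i (m : ZMod (p ^ n)) = (((m : ℚ) / (p ^ n : ℕ) : ℚ) : AddCircle (1 : ℚ)) := by
    intro m
    have : (m : ZMod (p ^ n)) = m • 1 := by simp
    rw [this, map_nsmul, hi, ← AddCircle.coe_nsmul, nsmul_eq_mul, mul_one_div]
  refine ⟨i, ?_, ?_⟩
  · rw [injective_iff_map_eq_zero]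
    intro t ht
    have htv : ((t.val : ℕ) : ZMod (p ^ n)) = t := ZMod.natCast_zmod_val t
    rw [← htv, hi2, AddCircle.coe_eq_zero_iff] at ht
    obtain ⟨m, hm⟩ := ht
    rw [zsmul_eq_mul, mul_one, eq_div_iff hq] at hm
    have hm2 : m * (p ^ n : ℕ) = (t.val : ℤ) := by exact_mod_cast hm
    rw [← htv, ZMod.natCast_eq_zero_iff]
    have : ((p ^ n : ℕ) : ℤ) ∣ (t.val : ℤ) := ⟨m, by rw [← hm2]; ring⟩
    exact_mod_cast this
  · intro c hc
    induction c using QuotientAddGroup.induction_on with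
    | H x =>
      have hc' : ((p ^ n • x : ℚ) : AddCircle (1 : ℚ)) = 0 := hc
      rw [AddCircle.coe_eq_zero_iff] at hc'
      obtain ⟨m, hm⟩ := hc'
      rw [zsmul_eq_mul, mul_one, nsmul_eq_mul] at hm
      refine ⟨(m : ZMod (p ^ n)), ?_⟩
      have : (m : ZMod (p ^ n)) = m • 1 := by simp
      rw [this, map_zsmul, hi, ← AddCircle.coe_zsmul, zsmul_eq_mul, mul_one_div, hm,
        mul_div_assoc, mul_comm, div_mul_cancel₀ _ hq]

lemma exists_char {p : ℕ} (hp : p.Prime) {G : Type*} [AddCommGroup G] (n : ℕ) (v : G)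
    (hv : v ∉ (pPowSub p n : AddSubgroup G)) : ∃ χ : G →+ ZMod (p ^ n), χ v ≠ 0 := by
  let Q := G ⧸ (pPowSub p n : AddSubgroup G)
  have hv' : (QuotientAddGroup.mk v : Q) ≠ 0 := by
    rwa [Ne, QuotientAddGroup.eq_zero_iff]
  obtain ⟨c, hc⟩ := CharacterModule.exists_character_apply_ne_zero_of_ne_zero hv'
  let c' : Q →+ AddCircle (1 : ℚ) := c
  let d : G →+ AddCircle (1 : ℚ) := c'.comp (QuotientAddGroup.mk' _)
  obtain ⟨i, hi, hr⟩ := zmod_circle hp n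
  have hd : ∀ x, d x ∈ i.range := by
    intro x
    apply hr
    rw [← map_nsmul]
    have : (QuotientAddGroup.mk (p ^ n • x) : Q) = 0 := by
      rw [QuotientAddGroup.eq_zero_iff]; exact mem_pPow.mpr ⟨x, rfl⟩
    change c' (QuotientAddGroup.mk (p ^ n • x) : Q) = 0
    rw [this, map_zero]
  refine ⟨((AddMonoidHom.ofInjective hi).symm : i.range →+ ZMod (p ^ n)).comp
    (d.codRestrict i.range hd), ?_⟩
  intro h
  apply hc
  have : (d.codRestrict i.range hd) v = 0 := by
    have h' : (AddMonoidHom.ofInjective hi).symm ((d.codRestrict i.range hd) v) = 0 := h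
    simpa using h'
  exact congrArg Subtype.val this

end PartTwo

section PartThree

open AddSubgroup

/-- endomorphisms under which X is inert -/
def Lam {G : Type*} [AddCommGroup G] (X : AddSubgroup G) (φ : G →+ G) : Prop := ALE (X.map φ) X

lemma Lam.add {G : Type*} [AddCommGroup G] {X : AddSubgroup G} {φ ψ : G →+ G}
    (h : Lam X φ) (h' : Lam X ψ) : Lam X (φ + ψ) := by
  refine ALE.trans (ALE.of_le ?_) (ALE.sup h h')
  rintro _ ⟨x, hx, rfl⟩
  exact add_mem (mem_sup_left ⟨x, hx, rfl⟩) (mem_sup_right ⟨x, hx, rfl⟩)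

lemma Lam.comp {G : Type*} [AddCommGroup G] {X : AddSubgroup G} {φ ψ : G →+ G}
    (h : Lam X φ) (h' : Lam X ψ) : Lam X (φ.comp ψ) := by
  unfold Lam
  rw [← AddSubgroup.map_map]
  exact (ALE.map φ h').trans h

lemma Lam.aut {p : ℕ} (hp : p.Prime) {G : Type*} [AddCommGroup G] (hG : IsPGroup' p G)
    {X : AddSubgroup G} (hX : CharInertSub X) (φ : G ≃+ G) : Lam X φ.toAddMonoidHom :=
  ALE.of_hatImage hp hG (hX φ)

lemma Lam.sqzero {p : ℕ} (hp : p.Prime) {G : Type*} [AddCommGroup G] (hG : IsPGroup' p G)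
    {X : AddSubgroup G} (hX : CharInertSub X) (φ : G →+ G) (h : ∀ x, φ (φ x) = 0) : Lam X φ := by
  let a : G ≃+ G :=
    { toFun := fun x => x + φ x
      invFun := fun x => x - φ x
      left_inv := fun x => by simp [h]
      right_inv := fun x => by simp [h]
      map_add' := fun x y => by rw [map_add]; abel }
  have h1 := Lam.aut hp hG hX a
  have h2 := Lam.aut hp hG hX (AddEquiv.neg G)
  have : φ = a.toAddMonoidHom + (AddEquiv.neg G).toAddMonoidHom := by
    ext x
    change φ x = (x + φ x) + (-x)
    abel
  rw [this]
  exact h1.add h2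

/-- swapping permutation -/
def swp : Equiv.Perm ℕ where
  toFun n := if n % 2 = 0 then n + 1 else n - 1
  invFun n := if n % 2 = 0 then n + 1 else n - 1
  left_inv n := by dsimp; split_ifs <;> omega
  right_inv n := by dsimp; split_ifs <;> omega

variable {G1 H : Type*} [AddCommGroup G1] [AddCommGroup H]

lemma Lam.corner {p : ℕ} (hp : p.Prime) (hG : IsPGroup' p (G1 × (ℕ →₀ H)))
    {X : AddSubgroup (G1 × (ℕ →₀ H))} (hX : CharInertSub X)
    (ψ : (ℕ →₀ H) →+ (ℕ →₀ H)) :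
    Lam X (((AddMonoidHom.inr G1 (ℕ →₀ H)).comp ψ).comp (AddMonoidHom.snd _ _)) := by
  let D : ((ℕ →₀ H) →+ (ℕ →₀ H)) → (G1 × (ℕ →₀ H) →+ G1 × (ℕ →₀ H)) := fun ψ =>
    ((AddMonoidHom.inr G1 (ℕ →₀ H)).comp ψ).comp (AddMonoidHom.snd _ _)
  have hD : ∀ ψ x, D ψ x = (0, ψ x.2) := fun ψ x => rfl
  let E : (ℕ →₀ H) →+ (ℕ →₀ H) := Finsupp.filterAddHom (fun n => n % 2 = 0)
  let O : (ℕ →₀ H) →+ (ℕ →₀ H) := Finsupp.filterAddHom (fun n => ¬ n % 2 = 0)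
  let t : (ℕ →₀ H) ≃+ (ℕ →₀ H) := Finsupp.domCongr swp
  let T : (G1 × (ℕ →₀ H)) ≃+ (G1 × (ℕ →₀ H)) := AddEquiv.prodCongr (AddEquiv.refl _) t
  have hEO : ∀ x, E x + O x = x := fun x => Finsupp.filter_add_filter_not x _
  have hE : ∀ x n, E x n = if n % 2 = 0 then x n else 0 := fun x n => Finsupp.filter_apply _ _ _
  have hO : ∀ x n, O x n = if ¬ n % 2 = 0 then x n else 0 := fun x n => Finsupp.filter_apply _ _ _
  have ht : ∀ x n, t x n = x (if n % 2 = 0 then n + 1 else n - 1) := fun x n => rfl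
  have hEO0 : ∀ x, E (O x) = 0 := by
    intro x; ext n; simp only [hE, hO]; split_ifs <;> simp
  have hOE0 : ∀ x, O (E x) = 0 := by
    intro x; ext n; simp only [hE, hO]; split_ifs <;> simp
  have htO : ∀ x, t (O (t x)) = E x := by
    intro x; ext n; simp only [ht, hE, hO]; split_ifs <;> first | omega | rfl
  have htE : ∀ x, t (E (t x)) = O x := by
    intro x; ext n; simp only [ht, hE, hO]; split_ifs <;> first | omega | rfl | skip
    all_goals congr 1
    all_goals omega
  have a1 : ∀ ψ : (ℕ →₀ H) →+ (ℕ →₀ H), Lam X (D ((O.comp ψ).comp E)) := fun ψ =>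
    Lam.sqzero hp hG hX _ (fun x => by simp [hD, hEO0])
  have a2 : ∀ ψ : (ℕ →₀ H) →+ (ℕ →₀ H), Lam X (D ((E.comp ψ).comp O)) := fun ψ =>
    Lam.sqzero hp hG hX _ (fun x => by simp [hD, hOE0])
  have a3 : Lam X (D ((E.comp ψ).comp E)) := by
    have : D ((E.comp ψ).comp E) =
        T.toAddMonoidHom.comp (D ((O.comp (t.toAddMonoidHom.comp ψ)).comp E)) := by
      apply AddMonoidHom.ext; intro x
      change ((0 : G1), E (ψ (E x.2))) = (0, t (O (t (ψ (E x.2)))))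
      rw [htO]
    rw [this]
    exact (Lam.aut hp hG hX T).comp (a1 _)
  have a4 : Lam X (D ((O.comp ψ).comp O)) := by
    have : D ((O.comp ψ).comp O) =
        T.toAddMonoidHom.comp (D ((E.comp (t.toAddMonoidHom.comp ψ)).comp O)) := by
      apply AddMonoidHom.ext; intro x
      change ((0 : G1), O (ψ (O x.2))) = (0, t (E (t (ψ (O x.2)))))
      rw [htE]
    rw [this]
    exact (Lam.aut hp hG hX T).comp (a2 _)
  have : D ψ = (D ((E.comp ψ).comp E) + D ((O.comp ψ).comp E)) +
      (D ((E.comp ψ).comp O) + D ((O.comp ψ).comp O)) := by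
    apply AddMonoidHom.ext; intro x
    simp only [AddMonoidHom.add_apply, hD, AddMonoidHom.comp_apply, Prod.mk_add_mk, hEO, add_zero,
      ← map_add]
  change Lam X (D ψ)
  rw [this]
  exact (a3.add (a1 ψ)).add ((a2 ψ).add a4)

lemma Lam.of_block {p : ℕ} (hp : p.Prime) (hG : IsPGroup' p (G1 × (ℕ →₀ H)))
    {X : AddSubgroup (G1 × (ℕ →₀ H))} (hX : CharInertSub X)
    (φ : G1 × (ℕ →₀ H) →+ G1 × (ℕ →₀ H)) (h : ∀ g, (φ (g, 0)).1 = 0) : Lam X φ := by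
  let i1 := AddMonoidHom.inl G1 (ℕ →₀ H)
  let i2 := AddMonoidHom.inr G1 (ℕ →₀ H)
  let s1 := AddMonoidHom.fst G1 (ℕ →₀ H)
  let s2 := AddMonoidHom.snd G1 (ℕ →₀ H)
  have e : φ = (i2.comp (s2.comp (φ.comp (i1.comp s1)))) +
      ((i1.comp (s1.comp (φ.comp (i2.comp s2)))) + (i2.comp (s2.comp (φ.comp i2))).comp s2) := by
    apply AddMonoidHom.ext; intro x
    have hx : φ x = φ (x.1, 0) + φ (0, x.2) := by
      rw [← map_add]; simp
    rw [hx]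
    simp only [i1, i2, s1, s2, AddMonoidHom.add_apply, AddMonoidHom.comp_apply]
    apply Prod.ext
    · simp [h]
    · simp
  have h00 : φ (0, 0) = 0 := map_zero φ
  rw [e]
  refine Lam.add ?_ (Lam.add ?_ ?_)
  · refine Lam.sqzero hp hG hX _ (fun x => ?_)
    simp [i1, i2, s1, s2, h00]
  · refine Lam.sqzero hp hG hX _ (fun x => ?_)
    simp [i1, i2, s1, s2, h00]
  · exact Lam.corner hp hG hX (s2.comp (φ.comp i2))

end PartThree

section PartThreeB

open AddSubgroup

variable {G1 H : Type*} [AddCommGroup G1] [AddCommGroup H]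

lemma diag_aux {p : ℕ} (hp : p.Prime) (hG : IsPGroup' p (G1 × (ℕ →₀ H)))
    {X : AddSubgroup (G1 × (ℕ →₀ H))} (hX : CharInertSub X) :
    ∃ (M : ℕ) (F : AddSubgroup (G1 × (ℕ →₀ H))), Finite F ∧
      ∀ (φ : (ℕ →₀ H) →+ G1 × (ℕ →₀ H)) (x : ℕ →₀ H), ((0 : G1), x) ∈ X →
        (∀ n < M, x n = 0) → φ x ∈ X ⊔ F := by
  by_contra hcon
  push Not at hcon
  let S := ℕ × {F : AddSubgroup (G1 × (ℕ →₀ H)) // Finite F}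
  have hc : ∀ s : S, ∃ (φ : (ℕ →₀ H) →+ G1 × (ℕ →₀ H)) (x : ℕ →₀ H), ((0 : G1), x) ∈ X ∧
      (∀ n < s.1, x n = 0) ∧ φ x ∉ X ⊔ s.2.1 := fun s => hcon s.1 s.2.1 s.2.2
  choose φ x hx1 hx2 hx3 using hc
  have hfin : ∀ g : G1 × (ℕ →₀ H), Finite (zmultiples g) := by
    intro g
    have := finite_closure_aux hp hG {g} (Set.finite_singleton g)
    rwa [← zmultiples_eq_closure] at this
  let step : S → S := fun s => (max (s.1 + 1) ((x s).support.sup id + 1),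
    ⟨s.2.1 ⊔ zmultiples (φ s (x s)), finite_sup_aux _ _ s.2.2 (hfin _)⟩)
  let st : ℕ → S := fun i => Nat.rec (0, ⟨⊥, inferInstance⟩) (fun _ s => step s) i
  have hst : ∀ i, st (i + 1) = step (st i) := fun i => rfl
  have hm : StrictMono (fun i => (st i).1) := by
    apply strictMono_nat_of_lt_succ
    intro i
    rw [hst]
    exact lt_of_lt_of_le (Nat.lt_succ_self _) (le_max_left _ _)
  have hxs : ∀ i n, x (st i) n ≠ 0 → (st i).1 ≤ n ∧ n < (st (i + 1)).1 := by
    intro i n hn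
    refine ⟨not_lt.mp fun h => hn (hx2 _ _ h), ?_⟩
    rw [hst]
    refine lt_of_lt_of_le ?_ (le_max_right _ _)
    exact Nat.lt_succ_of_le (Finset.le_sup (f := id) (Finsupp.mem_support_iff.mpr hn))
  have hFm : Monotone (fun i => (st i).2.1) := by
    apply monotone_nat_of_le_succ
    intro i
    rw [hst]
    exact le_sup_left
  let idx : ℕ → ℕ := fun n => Nat.findGreatest (fun i => (st i).1 ≤ n) n
  have hidx : ∀ i n, (st i).1 ≤ n → n < (st (i + 1)).1 → idx n = i := by
    intro i n h1 h2
    rw [Nat.findGreatest_eq_iff]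
    refine ⟨(hm.id_le i).trans h1, fun _ => h1, ?_⟩
    intro j hj _ h3
    have : (st (i + 1)).1 ≤ (st j).1 := hm.monotone (Nat.succ_le_of_lt hj)
    exact absurd (this.trans h3) (not_le.mpr h2)
  let Φ : (ℕ →₀ H) →+ G1 × (ℕ →₀ H) :=
    Finsupp.liftAddHom (fun n => (φ (st (idx n))).comp (Finsupp.singleAddHom n))
  have hΦ : ∀ i, Φ (x (st i)) = φ (st i) (x (st i)) := by
    intro i
    conv_rhs => rw [← Finsupp.sum_single (x (st i))]
    rw [map_finsuppSum]
    change (Finsupp.liftAddHom _) _ = _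
    rw [Finsupp.liftAddHom_apply]
    apply Finset.sum_congr rfl
    intro n hn
    obtain ⟨h1, h2⟩ := hxs i n (Finsupp.mem_support_iff.mp hn)
    simp only [AddMonoidHom.comp_apply, hidx i n h1 h2]
    rfl
  have hL : Lam X (Φ.comp (AddMonoidHom.snd G1 (ℕ →₀ H))) :=
    Lam.of_block hp hG hX _ (fun g => by simp)
  refine ALE.greedy hL (fun i => φ (st i) (x (st i))) ?_ (fun i => (st i).2.1) ?_ ?_
  · intro i
    exact ⟨(0, x (st i)), hx1 _, hΦ i⟩
  · intro i j hij
    refine hFm (Nat.succ_le_of_lt hij) ?_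
    simp only [Nat.succ_eq_add_one, hst]
    exact mem_sup_right (mem_zmultiples _)
  · intro i
    exact hx3 _

/-- first copy of H -/
noncomputable def io : H →+ G1 × (ℕ →₀ H) := (AddMonoidHom.inr G1 (ℕ →₀ H)).comp (Finsupp.singleAddHom 0)

lemma io_apply (h : H) : (io h : G1 × (ℕ →₀ H)) = (0, Finsupp.single 0 h) := rfl

/-- from the first copy of H -/
noncomputable def oi {K : Type*} [AddCommGroup K] (θ : H →+ K) : G1 × (ℕ →₀ H) →+ K :=
  (θ.comp (Finsupp.applyAddHom 0)).comp (AddMonoidHom.snd _ _)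

lemma oi_io {K : Type*} [AddCommGroup K] (θ : H →+ K) (h : H) :
    oi θ (io h : G1 × (ℕ →₀ H)) = θ h := by
  simp [oi, io_apply]

lemma exists_height {p : ℕ} {v : G1} (hv : v ∉ ulm p G1) :
    ∃ h, (∃ c, p ^ h • c = v) ∧ v ∉ (pPowSub p (h + 1) : AddSubgroup G1) := by
  by_contra hcon
  push Not at hcon
  apply hv
  rw [mem_ulm]
  intro n
  induction n with
  | zero => exact ⟨v, by simp⟩
  | succ n ih => exact mem_pPow.mp (hcon n ih)

lemma lem_one {p : ℕ} (hp : p.Prime)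
    (q0 : G1 →+ H)
    (hfac : ∀ b : G1 →+ (ℕ →₀ H), ∃ b' : H →+ (ℕ →₀ H), ∀ x, b x = b' (q0 x))
    (e : ℕ → H) (he : ∀ n, p ^ (n + 1) • e n = 0)
    (W : AddSubgroup (G1 × (ℕ →₀ H))) (hW : FullyInvariantSub W) (x : G1) (h k : ℕ) (hk : k ≤ h)
    (hx : io (q0 x) ∈ W) (hv : p ^ k • x ∉ (pPowSub p (h + 1) : AddSubgroup G1)) :
    io (p ^ (h - k) • e h) ∈ W := by
  obtain ⟨χ, hχ⟩ := exists_char hp (h + 1) _ hv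
  rw [map_nsmul] at hχ
  obtain ⟨m, hm⟩ := zmod_mult hp h k hk _ hχ
  obtain ⟨ψ, hψ⟩ := zmod_hom (p ^ (h + 1)) (e h) (he h)
  obtain ⟨b', hb'⟩ := hfac ((Finsupp.singleAddHom 0).comp (ψ.comp χ))
  have h1 : oi ((AddMonoidHom.inr G1 (ℕ →₀ H)).comp b') (io (q0 x)) ∈ W :=
    hW _ ⟨_, hx, rfl⟩
  rw [oi_io] at h1
  have h2 : io (ψ (χ x)) ∈ W := by
    rw [io_apply]
    have := hb' x
    simp only [AddMonoidHom.comp_apply, Finsupp.singleAddHom_apply] at this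
    rw [this]
    exact h1
  have h3 := W.zsmul_mem h2 m
  rwa [← map_zsmul, ← map_zsmul, hm, map_nsmul, hψ] at h3

lemma lem_four {p : ℕ} (hp : p.Prime)
    (q0 : G1 →+ H)
    (hfac : ∀ b : G1 →+ (ℕ →₀ H), ∃ b' : H →+ (ℕ →₀ H), ∀ x, b x = b' (q0 x))
    (e : ℕ → H) (he : ∀ n, p ^ (n + 1) • e n = 0)
    (hθ : ∀ n (g : G1 × (ℕ →₀ H)), p ^ (n + 1) • g = 0 →
      ∃ θ : H →+ G1 × (ℕ →₀ H), θ (e n) = g)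
    (W : AddSubgroup (G1 × (ℕ →₀ H))) (hW : FullyInvariantSub W) (k : ℕ)
    (hE : ∃ n, k ≤ n + 1 ∧ io (p ^ (n + 1 - k) • e n) ∈ W) :
    ∀ u : G1, p ^ k • u = 0 → io (q0 u) ∈ W → (u, 0) ∈ W := by
  induction k with
  | zero =>
    intro u hu _
    rw [pow_zero, one_smul] at hu
    rw [hu]; exact W.zero_mem
  | succ k ih =>
    intro u hu hq
    obtain ⟨n, hn, hnW⟩ := hE
    have ih := ih ⟨n, by omega, by
      have : n + 1 - k = (n + 1 - (k + 1)) + 1 := by omega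
      rw [this, pow_succ', mul_smul, map_nsmul]
      exact W.nsmul_mem hnW _⟩
    have key : ∃ n w, k ≤ n ∧ p ^ n • w = p ^ k • u ∧ io (p ^ (n - k) • e n) ∈ W := by
      by_cases hv : p ^ k • u ∈ ulm p G1
      · obtain ⟨w, hw⟩ := mem_ulm.mp hv n
        exact ⟨n, w, by omega, hw, by simpa using hnW⟩
      · obtain ⟨h, ⟨c, hc⟩, hh⟩ := exists_height hv
        have hkh : k ≤ h := by
          by_contra hlt
          push Not at hlt
          apply hh
          rw [mem_pPow]
          refine ⟨p ^ (k - (h + 1)) • u, ?_⟩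
          rw [← mul_smul, ← pow_add]
          congr 2
          omega
        exact ⟨h, c, hkh, hc, lem_one hp q0 hfac e he W hW u h k hkh hq hh⟩
    obtain ⟨n, w, hkn, hw, hnW⟩ := key
    have hw0 : p ^ (n + 1) • ((w, 0) : G1 × (ℕ →₀ H)) = 0 := by
      rw [Prod.smul_mk, smul_zero, pow_succ', mul_smul, hw, ← mul_smul, ← pow_succ', hu]
      rfl
    obtain ⟨θ, hθ⟩ := hθ n _ hw0
    have hz : ((p ^ (n - k) • w, 0) : G1 × (ℕ →₀ H)) ∈ W := by
      have h1 : oi θ (io (p ^ (n - k) • e n)) ∈ W := hW _ ⟨_, hnW, rfl⟩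
      rw [oi_io, map_nsmul, hθ, Prod.smul_mk, smul_zero] at h1
      exact h1
    have h2 := ih (u - p ^ (n - k) • w) (by
      rw [smul_sub, ← mul_smul, ← pow_add, add_tsub_cancel_of_le hkn, hw, sub_self]) (by
      rw [map_sub, map_sub]
      refine W.sub_mem hq ?_
      exact hW ((io.comp q0).comp (AddMonoidHom.fst _ _)) ⟨_, hz, rfl⟩)
    have h3 := W.add_mem h2 hz
    simpa using h3

lemma lem_five {p : ℕ} (hp : p.Prime) (hG1 : IsPGroup' p G1)
    (q0 : G1 →+ H)
    (hfac : ∀ b : G1 →+ (ℕ →₀ H), ∃ b' : H →+ (ℕ →₀ H), ∀ x, b x = b' (q0 x))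
    (e : ℕ → H) (he : ∀ n, p ^ (n + 1) • e n = 0)
    (hθ : ∀ n (g : G1 × (ℕ →₀ H)), p ^ (n + 1) • g = 0 →
      ∃ θ : H →+ G1 × (ℕ →₀ H), θ (e n) = g)
    (W : AddSubgroup (G1 × (ℕ →₀ H))) (hW : FullyInvariantSub W) (x u : G1)
    (hx : io (q0 x) ∈ W) (hu : io (q0 u) ∈ W)
    (hxu : ∀ k, p ^ k • x ∈ ulm p G1 → p ^ k • u = 0) : (u, 0) ∈ W := by
  let EE : ℕ → Prop := fun k => ∃ n, k ≤ n + 1 ∧ io (p ^ (n + 1 - k) • e n) ∈ W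
  by_cases hall : ∀ k, EE k
  · obtain ⟨k, hk⟩ := hG1 u
    exact lem_four hp q0 hfac e he hθ W hW k (hall k) u hk hu
  · have : ∃ K, EE K ∧ ¬ EE (K + 1) := by
      by_contra hcon
      push Not at hcon
      apply hall
      intro k
      induction k with
      | zero => exact ⟨0, by omega, by rw [Nat.sub_zero, he, map_zero]; exact W.zero_mem⟩
      | succ k ih => exact hcon k ih
    obtain ⟨K, hK, hK'⟩ := this
    refine lem_four hp q0 hfac e he hθ W hW K hK u (hxu K ?_) hu
    by_contra hv
    obtain ⟨h, ⟨c, hc⟩, hh⟩ := exists_height hv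
    have hkh : K ≤ h := by
      by_contra hlt
      push Not at hlt
      apply hh
      rw [mem_pPow]
      refine ⟨p ^ (K - (h + 1)) • x, ?_⟩
      rw [← mul_smul, ← pow_add]
      congr 2
      omega
    apply hK'
    refine ⟨h, by omega, ?_⟩
    have := lem_one hp q0 hfac e he W hW x h K hkh hx hh
    simpa using this

end PartThreeB

section PartThreeC

open AddSubgroup

variable {G1 H : Type*} [AddCommGroup G1] [AddCommGroup H]

theorem mci_main {p : ℕ} (hp : p.Prime) (hG : IsPGroup' p (G1 × (ℕ →₀ H)))
    (q0 : G1 →+ H) (hq0 : ∀ x ∈ ulm p G1, q0 x = 0)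
    (hfac : ∀ b : G1 →+ (ℕ →₀ H), ∃ b' : H →+ (ℕ →₀ H), ∀ x, b x = b' (q0 x))
    (e : ℕ → H) (he : ∀ n, p ^ (n + 1) • e n = 0)
    (hθ : ∀ n (g : G1 × (ℕ →₀ H)), p ^ (n + 1) • g = 0 →
      ∃ θ : H →+ G1 × (ℕ →₀ H), θ (e n) = g)
    (hU : ∀ a a' : G1 →+ G1, (∀ v ∈ ulm p G1, a (a' v) = v) →
      ∃ c : ℤ, ∀ v ∈ ulm p G1, a v = c • v) :
    MinCharInertia (G1 × (ℕ →₀ H)) := by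
  intro X hX
  have hG1 : IsPGroup' p G1 := by
    intro x
    obtain ⟨n, hn⟩ := hG (x, 0)
    exact ⟨n, congrArg Prod.fst hn⟩
  obtain ⟨M, F, hF, hMF⟩ := diag_aux hp hG hX
  let i2 := AddMonoidHom.inr G1 (ℕ →₀ H)
  let s2 := AddMonoidHom.snd G1 (ℕ →₀ H)
  let XM : AddSubgroup (ℕ →₀ H) := X.comap i2 ⊓ ⨅ n : {n // n < M}, (Finsupp.applyAddHom n.1).ker
  have hXM : ∀ x, x ∈ XM ↔ ((0 : G1), x) ∈ X ∧ ∀ n < M, x n = 0 := by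
    intro x
    simp only [XM, AddSubgroup.mem_inf, AddSubgroup.mem_iInf, AddSubgroup.mem_comap,
      AddMonoidHom.mem_ker, Subtype.forall]
    rfl
  let W : AddSubgroup (G1 × (ℕ →₀ H)) := ⨆ φ : (ℕ →₀ H) →+ G1 × (ℕ →₀ H), XM.map φ
  have hW : FullyInvariantSub W := by
    intro ψ
    rw [AddSubgroup.map_iSup]
    apply iSup_le
    intro φ
    rw [AddSubgroup.map_map]
    exact le_iSup (fun φ : (ℕ →₀ H) →+ G1 × (ℕ →₀ H) => XM.map φ) (ψ.comp φ)
  have hWm : ∀ ψ : (G1 × (ℕ →₀ H)) →+ (G1 × (ℕ →₀ H)), ∀ x ∈ W, ψ x ∈ W := fun ψ x hx =>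
    hW ψ ⟨x, hx, rfl⟩
  have hWX : ALE W X := by
    refine ⟨F, hF, iSup_le fun φ => ?_⟩
    rintro _ ⟨x, hx, rfl⟩
    exact hMF φ x ((hXM x).mp hx).1 ((hXM x).mp hx).2
  -- the shift
  let s : (ℕ →₀ H) →+ (ℕ →₀ H) := Finsupp.mapDomain.addMonoidHom (fun n => n + M)
  have hinj : Function.Injective (fun n : ℕ => n + M) := fun a b h => by simpa using h
  let s' : (ℕ →₀ H) →+ (ℕ →₀ H) := Finsupp.comapDomain.addMonoidHom hinj
  have hss : ∀ x, s' (s x) = x := by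
    intro x
    ext n
    change Finsupp.mapDomain (fun n => n + M) x (n + M) = x n
    exact Finsupp.mapDomain_apply hinj x n
  have hsM : ∀ x, ∀ n < M, s x n = 0 := by
    intro x n hn
    change Finsupp.mapDomain (fun n => n + M) x n = 0
    apply Finsupp.mapDomain_of_notMem_range
    rintro ⟨m, hm⟩
    simp only at hm
    omega
  let Y : AddSubgroup (G1 × (ℕ →₀ H)) := X ⊓ (AddMonoidHom.fst G1 (ℕ →₀ H)).ker
  have hY : ALE Y W := by
    let S := (i2.comp s).comp s2
    have hS : Lam X S := Lam.of_block hp hG hX S (fun g => by simp [S, i2])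
    have h1 : ALE (Y.map S) X := (ALE.of_le (AddSubgroup.map_mono inf_le_left)).trans hS
    refine (ALE.comap hp hG S h1).trans (ALE.of_le ?_)
    rintro ⟨g, y⟩ ⟨⟨hy1, hy2⟩, hy3⟩
    have hg : g = 0 := hy2
    subst hg
    have h2 : s y ∈ XM := (hXM _).mpr ⟨hy3, hsM y⟩
    have h3 : (i2.comp s') (s y) ∈ W :=
      (le_iSup (fun φ : (ℕ →₀ H) →+ G1 × (ℕ →₀ H) => XM.map φ) (i2.comp s')) ⟨_, h2, rfl⟩
    rw [AddMonoidHom.comp_apply, hss] at h3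
    exact h3
  let Z : AddSubgroup (G1 × (ℕ →₀ H)) := X ⊓ s2.ker
  have hXZY : ALE X (Z ⊔ Y) := by
    have hS : Lam X (i2.comp s2) := Lam.of_block hp hG hX _ (fun g => by simp [i2])
    refine (ALE.comap hp hG _ hS).trans (ALE.of_le ?_)
    rintro ⟨g, y⟩ ⟨h1, h2⟩
    have h2 : ((0 : G1), y) ∈ X := h2
    have h3 : (g, (0 : ℕ →₀ H)) ∈ X := by simpa using X.sub_mem h1 h2
    have h4 : (g, y) = (g, (0 : ℕ →₀ H)) + ((0 : G1), y) := by simp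
    rw [h4]
    exact add_mem (mem_sup_left ⟨h3, rfl⟩) (mem_sup_right ⟨h2, rfl⟩)
  let κ : (G1 × (ℕ →₀ H)) →+ (G1 × (ℕ →₀ H)) := (io.comp q0).comp (AddMonoidHom.fst _ _)
  let Zs : AddSubgroup (G1 × (ℕ →₀ H)) := Z ⊓ W.comap κ
  have hZ : ALE Z Zs := by
    have hS : Lam X κ := Lam.of_block hp hG hX _ (fun g => by simp [κ, io_apply])
    have h1 : ALE (Z.map κ) X := (ALE.of_le (AddSubgroup.map_mono inf_le_left)).trans hS
    refine (ALE.comap hp hG κ h1).trans ?_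
    have h2 : ALE ((Z ⊓ X.comap κ).map κ) W := by
      refine (ALE.of_le ?_).trans hY
      rintro _ ⟨z, hz, rfl⟩
      exact ⟨hz.2, rfl⟩
    refine (ALE.comap hp hG κ h2).trans (ALE.of_le ?_)
    exact inf_le_inf_right _ inf_le_left
  refine ⟨Zs ⊔ W, ?_, ALE.commens ?_ ?_⟩
  · intro α
    rw [AddSubgroup.map_sup]
    refine sup_le ?_ ((hW _).trans le_sup_right)
    rintro _ ⟨⟨x, y⟩, hz, rfl⟩
    have hy : y = 0 := hz.1.2
    subst hy
    have hx : io (q0 x) ∈ W := hz.2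
    let a : G1 →+ G1 := ((AddMonoidHom.fst G1 (ℕ →₀ H)).comp α.toAddMonoidHom).comp
      (AddMonoidHom.inl _ _)
    let a' : G1 →+ G1 := ((AddMonoidHom.fst G1 (ℕ →₀ H)).comp α.symm.toAddMonoidHom).comp
      (AddMonoidHom.inl _ _)
    let b : G1 →+ (ℕ →₀ H) := ((AddMonoidHom.snd G1 (ℕ →₀ H)).comp α.toAddMonoidHom).comp
      (AddMonoidHom.inl _ _)
    let b2 : G1 →+ (ℕ →₀ H) := ((AddMonoidHom.snd G1 (ℕ →₀ H)).comp α.symm.toAddMonoidHom).comp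
      (AddMonoidHom.inl _ _)
    have hα : ∀ x, α (x, 0) = (a x, b x) := fun x => rfl
    have hα' : ∀ x, α.symm (x, 0) = (a' x, b2 x) := fun x => rfl
    have hb2 : ∀ v ∈ ulm p G1, b2 v = 0 := by
      obtain ⟨b', hb'⟩ := hfac b2
      intro v hv
      rw [hb', hq0 v hv, map_zero]
    have haa : ∀ v ∈ ulm p G1, a (a' v) = v := by
      intro v hv
      have h1 := hα' v
      rw [hb2 v hv] at h1
      have h2 := α.apply_symm_apply (v, 0)
      rw [h1, hα] at h2
      exact congrArg Prod.fst h2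
    obtain ⟨c, hc⟩ := hU a a' haa
    have htr : ∀ d : G1 →+ (ℕ →₀ H), ((0 : G1), d x) ∈ W := by
      intro d
      obtain ⟨d', hd'⟩ := hfac d
      have := hWm (oi (i2.comp d')) _ hx
      rw [oi_io] at this
      rw [hd']
      exact this
    have hu1 : io (q0 (a x - c • x)) ∈ W := by
      have := htr ((Finsupp.singleAddHom 0).comp (q0.comp (a - c • AddMonoidHom.id G1)))
      exact this
    have hu : (a x - c • x, (0 : ℕ →₀ H)) ∈ W := by
      refine lem_five hp hG1 q0 hfac e he hθ W hW x _ hx hu1 ?_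
      intro k hk
      have := hc _ hk
      rw [map_nsmul] at this
      rw [smul_sub, this, smul_comm, sub_self]
    have hfin : α (x, 0) = c • (x, (0 : ℕ →₀ H)) + ((a x - c • x, (0 : ℕ →₀ H)) + (0, b x)) := by
      rw [hα]
      simp
    change α (x, 0) ∈ _
    rw [hfin]
    exact add_mem (mem_sup_left (Zs.zsmul_mem hz c)) (mem_sup_right (add_mem hu (htr b)))
  · refine hXZY.trans (ALE.sup (hZ.trans (ALE.of_le le_sup_left)) (hY.trans (ALE.of_le le_sup_right)))
  · exact ALE.sup (ALE.of_le (inf_le_left.trans inf_le_left)) hWX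

end PartThreeC

section PartThreeD

open AddSubgroup

lemma ulm_bot_of {p : ℕ} {K : Type*} [AddCommGroup K] (h : ∀ x ∈ ulm p K, x = 0) :
    ulm p K = ⊥ := (AddSubgroup.eq_bot_iff_forall _).mpr h

lemma pgroup_add {p : ℕ} {K : Type*} [AddCommGroup K] {x y : K} (hx : ∃ n : ℕ, p ^ n • x = 0)
    (hy : ∃ n : ℕ, p ^ n • y = 0) : ∃ n : ℕ, p ^ n • (x + y) = 0 := by
  obtain ⟨n, hn⟩ := hx
  obtain ⟨m, hm⟩ := hy
  refine ⟨n + m, ?_⟩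
  rw [smul_add]
  nth_rewrite 1 [pow_add, mul_comm]
  rw [pow_add, mul_smul, mul_smul, hn, hm]
  simp

lemma pgroup_map {p : ℕ} {K L : Type*} [AddCommGroup K] [AddCommGroup L] (f : K →+ L) {x : K}
    (hx : ∃ n : ℕ, p ^ n • x = 0) : ∃ n : ℕ, p ^ n • f x = 0 := by
  obtain ⟨n, hn⟩ := hx
  exact ⟨n, by rw [← map_nsmul, hn, map_zero]⟩

lemma pgroup_prod {p : ℕ} {K L : Type*} [AddCommGroup K] [AddCommGroup L] (hK : IsPGroup' p K)
    (hL : IsPGroup' p L) : IsPGroup' p (K × L) := by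
  rintro ⟨x, y⟩
  have h1 := pgroup_map (AddMonoidHom.inl K L) (hK x)
  have h2 := pgroup_map (AddMonoidHom.inr K L) (hL y)
  have := pgroup_add h1 h2
  simpa using this

lemma pgroup_finsupp {p : ℕ} {K : Type*} [AddCommGroup K] (hK : IsPGroup' p K) :
    IsPGroup' p (ℕ →₀ K) := by
  intro x
  induction x using Finsupp.induction_linear with
  | zero => exact ⟨0, by simp⟩
  | add f g hf hg => exact pgroup_add hf hg
  | single n a => exact pgroup_map (Finsupp.singleAddHom n) (hK a)

/-- the direct sum of cyclic groups -/
abbrev BB (p : ℕ) : Type := Π₀ n : ℕ, ZMod (p ^ (n + 1))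

lemma zmod_kill {p n : ℕ} (x : ZMod (p ^ n)) : p ^ n • x = 0 := by
  have h0 : ((p ^ n : ℕ) : ZMod (p ^ n)) = 0 := ZMod.natCast_self _
  rw [nsmul_eq_mul, h0, zero_mul]

lemma pgroup_BB {p : ℕ} : IsPGroup' p (BB p) := by
  intro x
  induction x using DFinsupp.induction with
  | h0 => exact ⟨0, by simp⟩
  | ha i b f _ _ hf =>
    refine pgroup_add ?_ hf
    exact pgroup_map (DFinsupp.singleAddHom (fun n : ℕ => ZMod (p ^ (n + 1))) i)
      ⟨i + 1, zmod_kill b⟩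

lemma ulm_BB {p : ℕ} : ∀ x ∈ ulm p (BB p), x = 0 := by
  intro x hx
  ext n : 1
  have := ulm_map (DFinsupp.evalAddMonoidHom n : BB p →+ ZMod (p ^ (n + 1))) hx
  obtain ⟨y, hy⟩ := mem_ulm.mp this (n + 1)
  rw [zmod_kill] at hy
  exact hy.symm

lemma ulm_quot {p : ℕ} {K : Type*} [AddCommGroup K] : ∀ x ∈ ulm p (K ⧸ ulm p K), x = 0 := by
  intro x hx
  induction x using QuotientAddGroup.induction_on with
  | H x =>
    rw [QuotientAddGroup.eq_zero_iff, mem_ulm]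
    intro n
    obtain ⟨y, hy⟩ := mem_ulm.mp hx n
    induction y using QuotientAddGroup.induction_on with
    | H y =>
      have h1 : -(p ^ n • y) + x ∈ ulm p K := (QuotientAddGroup.eq).mp hy
      obtain ⟨z, hz⟩ := mem_ulm.mp h1 n
      refine ⟨y + z, ?_⟩
      rw [smul_add, hz]
      abel

lemma ulm_prod {p : ℕ} {K L : Type*} [AddCommGroup K] [AddCommGroup L]
    (hK : ∀ x ∈ ulm p K, x = 0) (hL : ∀ x ∈ ulm p L, x = 0) : ∀ x ∈ ulm p (K × L), x = 0 :=
  fun _ hx => Prod.ext (hK _ (ulm_map (AddMonoidHom.fst K L) hx))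
    (hL _ (ulm_map (AddMonoidHom.snd K L) hx))

lemma ulm_finsupp {p : ℕ} {K : Type*} [AddCommGroup K]
    (hK : ∀ x ∈ ulm p K, x = 0) : ∀ x ∈ ulm p (ℕ →₀ K), x = 0 := by
  intro x hx
  ext n
  exact hK _ (ulm_map (Finsupp.applyAddHom n) hx)

theorem struct_gen (p : ℕ) (hp : p.Prime) (G1 H : Type) [AddCommGroup G1] [AddCommGroup H]
    (hHp : IsPGroup' p H) (hHu0 : ∀ x ∈ ulm p H, x = 0)
    (q0 : G1 →+ H) (hq0 : ∀ x ∈ ulm p G1, q0 x = 0)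
    (hfac : ∀ b : G1 →+ (ℕ →₀ H), ∃ b' : H →+ (ℕ →₀ H), ∀ x, b x = b' (q0 x))
    (e : ℕ → H) (he : ∀ n, p ^ (n + 1) • e n = 0)
    (hθ : ∀ n (g : G1 × (ℕ →₀ H)), p ^ (n + 1) • g = 0 →
      ∃ θ : H →+ G1 × (ℕ →₀ H), θ (e n) = g)
    (hG1 : IsPGroup' p G1) (hpV : ∀ v ∈ ulm p G1, p • v = 0) (hV : ulm p G1 ≠ ⊥)
    (hU : ∀ a a' : G1 →+ G1, (∀ v ∈ ulm p G1, a (a' v) = v) →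
      ∃ c : ℤ, ∀ v ∈ ulm p G1, a v = c • v)
    (X0 : AddSubgroup G1) (hX0 : X0 ≤ ulm p G1) (hX0a : ∀ a : G1 →+ G1, ALE (X0.map a) X0)
    (hX0b : ∀ Y : AddSubgroup G1, Y ≤ ulm p G1 → FullyInvariantSub Y → ALE X0 Y → ALE Y X0 → False) :
    ∃ (G : Type) (_ : AddCommGroup G), IsPGroup' p G ∧
      (∀ x ∈ ⨅ n : ℕ, (pPowSub p n : AddSubgroup G), p • x = 0) ∧
      (⨅ n : ℕ, (pPowSub p n : AddSubgroup G)) ≠ ⊥ ∧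
      MinCharInertia G ∧ ¬ MinFullInertia G := by
  have hHu : ∀ x ∈ ulm p (ℕ →₀ H), x = 0 := ulm_finsupp hHu0
  have hG : IsPGroup' p (G1 × (ℕ →₀ H)) := pgroup_prod hG1 (pgroup_finsupp hHp)
  have hGu : ∀ x ∈ ulm p (G1 × (ℕ →₀ H)), x.1 ∈ ulm p G1 ∧ x.2 = 0 := by
    intro x hx
    have h1 := ulm_map (AddMonoidHom.fst G1 (ℕ →₀ H)) hx
    have h2 := ulm_map (AddMonoidHom.snd G1 (ℕ →₀ H)) hx
    exact ⟨h1, hHu _ h2⟩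
  refine ⟨G1 × (ℕ →₀ H), inferInstance, hG, ?_, ?_, ?_, ?_⟩
  · intro x hx
    obtain ⟨h1, h2⟩ := hGu x hx
    exact Prod.ext (hpV _ h1) (by rw [Prod.smul_snd, h2, smul_zero]; rfl)
  · intro hbot
    apply hV
    rw [AddSubgroup.eq_bot_iff_forall]
    intro v hv
    have h1 : AddMonoidHom.inl G1 (ℕ →₀ H) v ∈ ulm p (G1 × (ℕ →₀ H)) := ulm_map _ hv
    unfold ulm at h1
    rw [hbot] at h1
    exact congrArg Prod.fst (AddSubgroup.mem_bot.mp h1)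
  · exact mci_main hp hG q0 hq0 hfac e he hθ hU
  · intro hM
    let i1 := AddMonoidHom.inl G1 (ℕ →₀ H)
    let s1 := AddMonoidHom.fst G1 (ℕ →₀ H)
    have hi1 : Function.Injective i1 := fun a b h => congrArg Prod.fst h
    obtain ⟨Y, hY, hXY⟩ := hM (X0.map i1) (by
      intro φ
      apply ALE.finite_hat
      have : (X0.map i1).map φ ≤ (X0.map (s1.comp (φ.comp i1))).map i1 := by
        rintro _ ⟨_, ⟨x, hx, rfl⟩, rfl⟩
        refine ⟨_, ⟨x, hx, rfl⟩, ?_⟩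
        have h1 : φ (i1 x) ∈ ulm p _ := ulm_map φ (ulm_map i1 (hX0 hx))
        exact Prod.ext rfl (hGu _ h1).2.symm
      exact (ALE.of_le this).trans (ALE.map i1 (hX0a _)))
    obtain ⟨h1, h2⟩ := commens_iff.mp hXY
    refine hX0b (Y.comap i1 ⊓ ulm p G1) inf_le_right ?_ ?_ ?_
    · rintro φ _ ⟨x, hx, rfl⟩
      refine ⟨?_, ulm_map φ hx.2⟩
      exact hY (i1.comp (φ.comp s1)) ⟨_, hx.1, rfl⟩
    · rw [← AddSubgroup.relIndex_comap] at h1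
      refine (ALE.of_relIndex hp hG1 h1).trans (ALE.of_le ?_)
      exact fun x hx => ⟨hx.2, hX0 hx.1⟩
    · have h3 : ALE ((Y.comap i1 ⊓ ulm p G1).map i1) (X0.map i1) := by
        refine (ALE.of_le ?_).trans ((ALE.of_relIndex hp hG h2).trans (ALE.of_le inf_le_right))
        rintro _ ⟨x, hx, rfl⟩
        exact hx.1
      have h4 := (ALE.comap hp hG1 i1 h3)
      rw [AddSubgroup.comap_map_eq_self_of_injective hi1] at h4
      exact h4.trans (ALE.of_le inf_le_right)

lemma bb_theta {p : ℕ} {L K : Type} [AddCommGroup L] [AddCommGroup K] (n : ℕ) (g : K)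
    (hg : p ^ (n + 1) • g = 0) : ∃ θ : L × BB p →+ K, θ (0, DFinsupp.single n 1) = g := by
  obtain ⟨ψ, hψ⟩ := zmod_hom (p ^ (n + 1)) g hg
  refine ⟨(ψ.comp (DFinsupp.evalAddMonoidHom n)).comp (AddMonoidHom.snd _ _), ?_⟩
  change ψ ((DFinsupp.single n (1 : ZMod (p ^ (n + 1))) : BB p) n) = g
  rw [DFinsupp.single_eq_same, hψ]

theorem struct_main (p : ℕ) (hp : p.Prime) (G1 : Type) [AddCommGroup G1]
    (hG1 : IsPGroup' p G1) (hpV : ∀ v ∈ ulm p G1, p • v = 0) (hV : ulm p G1 ≠ ⊥)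
    (hU : ∀ a a' : G1 →+ G1, (∀ v ∈ ulm p G1, a (a' v) = v) →
      ∃ c : ℤ, ∀ v ∈ ulm p G1, a v = c • v)
    (X0 : AddSubgroup G1) (hX0 : X0 ≤ ulm p G1) (hX0a : ∀ a : G1 →+ G1, ALE (X0.map a) X0)
    (hX0b : ∀ Y : AddSubgroup G1, Y ≤ ulm p G1 → FullyInvariantSub Y → ALE X0 Y → ALE Y X0 → False) :
    ∃ (G : Type) (_ : AddCommGroup G), IsPGroup' p G ∧
      (∀ x ∈ ⨅ n : ℕ, (pPowSub p n : AddSubgroup G), p • x = 0) ∧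
      (⨅ n : ℕ, (pPowSub p n : AddSubgroup G)) ≠ ⊥ ∧
      MinCharInertia G ∧ ¬ MinFullInertia G := by
  have hHp : IsPGroup' p ((G1 ⧸ ulm p G1) × BB p) := by
    refine pgroup_prod ?_ pgroup_BB
    intro x
    induction x using QuotientAddGroup.induction_on with
    | H x => exact pgroup_map (QuotientAddGroup.mk' (ulm p G1)) (hG1 x)
  have hHu : ∀ x ∈ ulm p ((G1 ⧸ ulm p G1) × BB p), x = 0 := ulm_prod ulm_quot ulm_BB
  refine struct_gen p hp G1 ((G1 ⧸ ulm p G1) × BB p) hHp hHu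
    ((AddMonoidHom.inl _ _).comp (QuotientAddGroup.mk' (ulm p G1))) ?_ ?_
      (fun n => (0, DFinsupp.single n 1)) ?_ ?_ hG1 hpV hV hU X0 hX0 hX0a hX0b
  · intro x hx
    have : (QuotientAddGroup.mk' (ulm p G1)) x = 0 := (QuotientAddGroup.eq_zero_iff x).mpr hx
    rw [AddMonoidHom.comp_apply, this, map_zero]
  · intro b
    refine ⟨(QuotientAddGroup.lift (ulm p G1) b
      (fun v hv => ulm_finsupp hHu _ (ulm_map b hv))).comp
      (AddMonoidHom.fst _ _), fun x => rfl⟩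
  · intro n
    rw [Prod.smul_mk, smul_zero, ← DFinsupp.single_smul, zmod_kill, DFinsupp.single_zero]
    rfl
  · intro n g hg
    exact bb_theta n g hg

end PartThreeD

section PartFour

open Cardinal Set

lemma mk_span_lt {k V : Type} [Field k] [Countable k] [AddCommGroup V] [Module k V]
    (s : Set V) (hs : #s < 𝔠) : #(Submodule.span k s) < 𝔠 := by
  have h1 : #(Submodule.span k s) ≤ #(s →₀ k) := by
    have h2 : Submodule.span k s = LinearMap.range (Finsupp.linearCombination k ((↑) : s → V)) := by
      rw [Finsupp.range_linearCombination, Subtype.range_coe]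
    rw [h2]
    exact Cardinal.mk_range_le
  refine h1.trans_lt ?_
  rcases finite_or_infinite s with h | h
  · have : Countable (s →₀ k) := inferInstance
    exact (Cardinal.mk_le_aleph0_iff.mpr this).trans_lt Cardinal.aleph0_lt_continuum
  · rw [Cardinal.mk_finsupp_of_infinite]
    exact max_lt hs ((Cardinal.mk_le_aleph0_iff.mpr inferInstance).trans_lt
      Cardinal.aleph0_lt_continuum)

lemma exists_functional {k V T : Type} [Field k] [AddCommGroup V] [Module k V] [LinearOrder T]
    (E0 : Set V) (w : T → V) (hw : ∀ t, w t ∉ Submodule.span k (E0 ∪ w '' Set.Iio t)) (c : T → k) :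
    ∃ f : V →ₗ[k] k, (∀ e ∈ E0, f e = 0) ∧ ∀ t, f (w t) = c t := by
  let N := Submodule.span k E0
  have hli : LinearIndependent k (fun t => N.mkQ (w t)) := by
    rw [linearIndependent_iff]
    intro l hl
    by_contra hne
    have hsn : l.support.Nonempty := Finsupp.support_nonempty_iff.mpr hne
    let t := l.support.max' hsn
    have ht : t ∈ l.support := l.support.max'_mem hsn
    have hlt : l t ≠ 0 := Finsupp.mem_support_iff.mp ht
    apply hw t
    have h1 : Finsupp.linearCombination k w l ∈ N := by
      rw [← Submodule.Quotient.mk_eq_zero, ← Submodule.mkQ_apply, ← hl]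
      simp only [Finsupp.linearCombination_apply, Finsupp.sum, map_sum, map_smul]
    rw [Finsupp.linearCombination_apply, Finsupp.sum, ← Finset.add_sum_erase _ _ ht] at h1
    have h2 : ∑ s ∈ l.support.erase t, l s • w s ∈
        Submodule.span k (E0 ∪ w '' Set.Iio t) := by
      refine Submodule.sum_mem _ fun s hs => Submodule.smul_mem _ _ (Submodule.subset_span ?_)
      refine Or.inr ⟨s, ?_, rfl⟩
      rw [Finset.mem_erase] at hs
      exact lt_of_le_of_ne (l.support.le_max' s hs.2) hs.1
    have h3 := Submodule.sub_mem _ (Submodule.span_mono subset_union_left h1) h2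
    rw [add_sub_cancel_right] at h3
    exact (Submodule.smul_mem_iff _ hlt).mp h3
  obtain ⟨g, hg⟩ := LinearMap.exists_extend ((Finsupp.linearCombination k c).comp
    (hli.repr : _ →ₗ[k] (T →₀ k)))
  refine ⟨g.comp N.mkQ, ?_, ?_⟩
  · intro e he
    have : N.mkQ e = 0 := by
      rw [Submodule.mkQ_apply, Submodule.Quotient.mk_eq_zero]
      exact Submodule.subset_span he
    rw [LinearMap.comp_apply, this, map_zero]
  · intro t
    have hm : N.mkQ (w t) ∈ Submodule.span k (Set.range fun t => N.mkQ (w t)) :=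
      Submodule.subset_span ⟨t, rfl⟩
    have h1 := LinearMap.congr_fun hg ⟨_, hm⟩
    simp only [LinearMap.comp_apply, Submodule.subtype_apply] at h1
    rw [LinearMap.comp_apply, h1]
    have := hli.repr_eq_single t ⟨_, hm⟩ rfl
    change Finsupp.linearCombination k c (hli.repr ⟨_, hm⟩) = c t
    rw [this]
    simp

lemma transf {k V J : Type} [Field k] [Countable k] [AddCommGroup V] [Module k V]
    [LinearOrder J] [WellFoundedLT J] (hJ : ∀ j : J, #(Set.Iio j) < 𝔠)
    (E0 : Set V) (hE0 : #E0 < 𝔠) (P : J → V → V → Prop) (v : J → k)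
    (hP : ∀ j (s : Set V), #s < 𝔠 → ∃ x y, P j x y ∧ x ∉ Submodule.span k s ∧
      y ∉ Submodule.span k (insert x s)) :
    ∃ f : V →ₗ[k] k, (∀ e ∈ E0, f e = 0) ∧ ∀ j, ∃ x y, P j x y ∧ f x = 0 ∧ f y = v j := by
  choose! X Y hXY hX hY using hP
  let s : (j : J) → ((i : J) → i < j → V × V) → Set V := fun j r =>
    E0 ∪ (Set.range (fun i : Set.Iio j => (r i.1 i.2).1) ∪ Set.range (fun i : Set.Iio j => (r i.1 i.2).2))
  have hs : ∀ j r, #(s j r) < 𝔠 := by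
    intro j r
    have hc := Cardinal.aleph0_le_continuum
    refine (Cardinal.mk_union_le _ _).trans_lt (Cardinal.add_lt_of_lt hc hE0 ?_)
    refine (Cardinal.mk_union_le _ _).trans_lt (Cardinal.add_lt_of_lt hc ?_ ?_)
    · exact Cardinal.mk_range_le.trans_lt (hJ j)
    · exact Cardinal.mk_range_le.trans_lt (hJ j)
  obtain ⟨z, hz⟩ : ∃ z : J → V × V, ∀ j, z j =
      (X j (s j (fun i _ => z i)), Y j (s j (fun i _ => z i))) :=
    ⟨(wellFounded_lt (α := J)).fix (fun j r => (X j (s j r), Y j (s j r))),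
      fun j => WellFounded.fix_eq _ _ _⟩
  let S : J → Set V := fun j => s j (fun i _ => z i)
  have hS : ∀ j, #(S j) < 𝔠 := fun j => hs j (fun i _ => z i)
  have hz : ∀ j, z j = (X j (S j), Y j (S j)) := hz
  let w : J ×ₗ Bool → V := fun t => if (ofLex t).2 then (z (ofLex t).1).2 else (z (ofLex t).1).1
  obtain ⟨f, hf0, hf⟩ := exists_functional E0 w (k := k) (by
    intro t
    obtain ⟨⟨j, b⟩, rfl⟩ := toLex.surjective t
    have hold : ∀ i < j, ∀ b, w (toLex (i, b)) ∈ S j := by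
      intro i hi b
      refine Or.inr ?_
      cases b
      · exact Or.inl ⟨⟨i, hi⟩, rfl⟩
      · exact Or.inr ⟨⟨i, hi⟩, rfl⟩
    cases b
    · change (z j).1 ∉ _
      rw [hz]
      intro hmem
      apply hX j (S j) (hS j)
      refine Submodule.span_mono ?_ hmem
      apply Set.union_subset Set.subset_union_left
      rintro _ ⟨t, ht, rfl⟩
      obtain ⟨⟨i, b⟩, rfl⟩ := toLex.surjective t
      rw [Set.mem_Iio, Prod.Lex.toLex_lt_toLex] at ht
      rcases ht with ht | ht
      · exact hold i ht b
      · exact absurd (show b < false from ht.2) (by cases b <;> decide)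
    · change (z j).2 ∉ _
      rw [hz]
      intro hmem
      apply hY j (S j) (hS j)
      refine Submodule.span_mono ?_ hmem
      apply Set.union_subset (Set.subset_union_left.trans (Set.subset_insert _ _))
      rintro _ ⟨t, ht, rfl⟩
      obtain ⟨⟨i, b⟩, rfl⟩ := toLex.surjective t
      rw [Set.mem_Iio, Prod.Lex.toLex_lt_toLex] at ht
      rcases ht with ht | ht
      · exact Or.inr (hold i ht b)
      · obtain ⟨h1, h2⟩ := ht
        simp only at h1 h2
        subst h1
        cases b
        · left
          change (z i).1 = _
          rw [hz]
        · simp at h2)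
    (fun t => if (ofLex t).2 then v (ofLex t).1 else 0)
  refine ⟨f, hf0, fun j => ⟨(z j).1, (z j).2, ?_, ?_, ?_⟩⟩
  · rw [hz]; exact hXY j (S j) (hS j)
  · exact hf (toLex (j, false))
  · exact hf (toLex (j, true))

end PartFour

section PartFourB

open Cardinal Set

/-- filtration preserving maps -/
def Filt {A B : Type} [AddCommGroup A] [AddCommGroup B] (M : (ℕ → A) →+ (ℕ → B)) : Prop :=
  ∀ j s, (∀ n < j, s n = 0) → ∀ n < j, M s n = 0

lemma step_small {A B : Type} [AddCommGroup A] [AddCommGroup B] (N : (ℕ → A) →+ (ℕ → B))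
    (hN : Filt N) (U : Set (ℕ → B)) (hU : #U < 𝔠) (hNU : ∀ s, N s ∈ U) :
    ∃ m, ∀ s, (∀ n < m, s n = 0) → N s = 0 := by
  by_contra hcon
  push Not at hcon
  choose s hs hNs using hcon
  have : ∀ m, ∃ d, N (s m) d ≠ 0 := by
    intro m
    by_contra h
    push Not at h
    exact hNs m (funext h)
  choose d hd using this
  have hdm : ∀ m, m ≤ d m := fun m => not_lt.mp fun h => hd m (hN m (s m) (hs m) _ h)
  obtain ⟨mm, hm⟩ : ∃ mm : ℕ → ℕ, ∀ i, mm (i + 1) = d (mm i) + 1 :=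
    ⟨fun i => Nat.rec 0 (fun _ m => d m + 1) i, fun i => rfl⟩
  have hmono : StrictMono mm := strictMono_nat_of_lt_succ fun i => by
    rw [hm]; exact Nat.lt_succ_of_le (hdm _)
  let S : (ℕ → ℤ) → (ℕ → A) := fun c n => ∑ j ∈ Finset.range (n + 1), c j • s (mm j) n
  have hSsub : ∀ c c', S c - S c' = S (c - c') := by
    intro c c'
    funext n
    simp only [S, Pi.sub_apply, sub_smul, Finset.sum_sub_distrib]
  have hSc : ∀ c i, (∀ j < i, c j = 0) → N (S c) (d (mm i)) = c i • N (s (mm i)) (d (mm i)) := by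
    intro c i hc
    have h1 : ∀ n < mm (i + 1), (S c - c i • s (mm i)) n = 0 := by
      intro n hn
      simp only [S, Pi.sub_apply, Pi.smul_apply]
      rw [sub_eq_zero]
      apply Finset.sum_eq_single i
      · intro j _ hji
        rcases lt_or_gt_of_ne hji with h | h
        · rw [hc j h, zero_smul]
        · rw [hs (mm j) n (hn.trans_le (hmono.monotone h)), smul_zero]
      · intro hi
        rw [hs (mm i) n, smul_zero]
        rw [Finset.mem_range] at hi
        have := hmono.id_le i
        simp only [id] at this
        omega
    have h2 := hN _ _ h1 (d (mm i)) (by rw [hm]; omega)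
    rw [map_sub, map_zsmul, Pi.sub_apply, Pi.smul_apply, sub_eq_zero] at h2
    exact h2
  let ind : (ℕ → Bool) → (ℕ → ℤ) := fun ε n => if ε n then 1 else 0
  have hinj : Function.Injective (fun ε : ℕ → Bool => (⟨N (S (ind ε)), hNU _⟩ : U)) := by
    intro ε δ h
    have h : N (S (ind ε)) = N (S (ind δ)) := congrArg Subtype.val h
    by_contra hne
    have hex : ∃ i, ε i ≠ δ i := by
      by_contra h'
      push Not at h'
      exact hne (funext h')
    classical
    have h1 := Nat.find_spec hex
    have h2 : ∀ j < Nat.find hex, (ind ε - ind δ) j = 0 := by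
      intro j hj
      have := Nat.find_min hex hj
      push Not at this
      simp [ind, this]
    have h3 := hSc _ _ h2
    rw [← hSsub, map_sub, h, sub_self, Pi.zero_apply] at h3
    have h4 := hd (mm (Nat.find hex))
    revert h1 h3
    simp only [ind, Pi.sub_apply]
    cases ε (Nat.find hex) <;> cases δ (Nat.find hex) <;> simp [h4, h4.symm]
  have := Cardinal.mk_le_of_injective hinj
  have h2 : #(ℕ → Bool) = 𝔠 := by simp
  rw [h2] at this
  exact absurd this (not_le.mpr hU)

variable {A k : Type} [CommRing A] [Field k] [Algebra A k]

/-- coordinatewise embedding -/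
def ia (A k : Type) [CommRing A] [Field k] [Algebra A k] : (ℕ → A) →+ (ℕ → k) :=
  (algebraMap A k).toAddMonoidHom.compLeft ℕ

lemma ia_apply (s : ℕ → A) (n : ℕ) : ia A k s n = algebraMap A k (s n) := rfl

/-- eventually scalar maps -/
def Triv (k : Type) [Field k] [Algebra A k] (M : (ℕ → A) →+ (ℕ → A)) : Prop :=
  ∃ (r : k) (m : ℕ), ∀ s, (∀ n < m, s n = 0) → ia A k (M s) = r • ia A k s

lemma exists_outside [Countable k] [Nontrivial A] (hinj : Function.Injective (algebraMap A k))
    (s : Set (ℕ → k)) (hs : #s < 𝔠) : ∃ a, ia A k a ∉ Submodule.span k s := by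
  by_contra hcon
  push Not at hcon
  have h1 := mk_span_lt (k := k) s hs
  have hi : Function.Injective (fun ε : ℕ → Bool =>
      (⟨ia A k (fun n => if ε n then 1 else 0), hcon _⟩ : Submodule.span k s)) := by
    intro ε δ h
    have h : ia A k (fun n => if ε n then 1 else 0) = ia A k (fun n => if δ n then 1 else 0) :=
      congrArg Subtype.val h
    funext n
    have h2 : (if ε n then (1 : A) else 0) = if δ n then 1 else 0 := hinj (congrFun h n)
    revert h2
    cases ε n <;> cases δ n <;> simp
  have := Cardinal.mk_le_of_injective hi
  have h2 : #(ℕ → Bool) = 𝔠 := by simp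
  rw [h2] at this
  exact absurd this (not_le.mpr h1)

lemma insert_lt {V : Type} (s : Set V) (hs : #s < 𝔠) (x : V) : #(insert x s : Set V) < 𝔠 :=
  Cardinal.mk_insert_le.trans_lt (Cardinal.add_lt_of_lt Cardinal.aleph0_le_continuum hs
    (Cardinal.one_lt_aleph0.trans Cardinal.aleph0_lt_continuum))

lemma step_main [Countable k] [Nontrivial A] (hinj : Function.Injective (algebraMap A k))
    (M : (ℕ → A) →+ (ℕ → A)) (hM : Filt M) (hT : ¬ Triv k M) (s : Set (ℕ → k)) (hs : #s < 𝔠) :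
    ∃ a, ia A k a ∉ Submodule.span k s ∧ ia A k (M a) ∉ Submodule.span k (insert (ia A k a) s) := by
  by_contra hcon
  push Not at hcon
  let U := Submodule.span k s
  let q := U.mkQ
  have hq : ∀ v, q v = 0 ↔ v ∈ U := fun v => by
    rw [Submodule.mkQ_apply, Submodule.Quotient.mk_eq_zero]
  let x : (ℕ → A) →+ ((ℕ → k) ⧸ U) := q.toAddMonoidHom.comp (ia A k)
  let y : (ℕ → A) →+ ((ℕ → k) ⧸ U) := x.comp M
  have hx : ∀ a, x a = q (ia A k a) := fun a => rfl
  have hy : ∀ a, y a = q (ia A k (M a)) := fun a => rfl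
  have hxy : ∀ a, x a ≠ 0 → ∃ r : k, y a = r • x a := by
    intro a ha
    have h1 := hcon a (by rwa [hx, Ne, hq] at ha)
    rw [Submodule.mem_span_insert] at h1
    obtain ⟨r, z, hz, h1⟩ := h1
    refine ⟨r, ?_⟩
    rw [hy, h1, map_add, map_smul, (hq z).mpr hz, add_zero, hx]
  obtain ⟨c0, hc0⟩ := exists_outside hinj s hs
  obtain ⟨c, hc⟩ := exists_outside hinj (insert (ia A k c0) s) (insert_lt s hs _)
  have hx0 : x c0 ≠ 0 := by rwa [hx, Ne, hq]
  have hxc : ∀ t : k, x c ≠ t • x c0 := by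
    intro t ht
    apply hc
    rw [Submodule.mem_span_insert]
    refine ⟨t, ia A k c - t • ia A k c0, ?_, by simp⟩
    rw [← hq, map_sub, map_smul, ← hx, ← hx, ht, sub_self]
  obtain ⟨r0, hr0⟩ := hxy c0 hx0
  have key : ∀ a, (∀ t : k, x a ≠ t • x c0) → y a = r0 • x a := by
    intro a ha
    have ha0 : x a ≠ 0 := by simpa using ha 0
    obtain ⟨r, hr⟩ := hxy a ha0
    have hac : x (a + c0) ≠ 0 := by
      intro h
      rw [map_add] at h
      apply ha (-1)
      rw [neg_one_smul]
      exact eq_neg_of_add_eq_zero_left h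
    obtain ⟨t, ht⟩ := hxy _ hac
    rw [map_add, map_add, hr, hr0, smul_add] at ht
    have h1 : (r - t) • x a = (t - r0) • x c0 := by
      rw [sub_smul, sub_smul, sub_eq_sub_iff_add_eq_add, ht]
      abel
    have h2 : r = t := by
      by_contra hne
      apply ha ((r - t)⁻¹ * (t - r0))
      rw [mul_smul, ← h1, smul_smul, inv_mul_cancel₀ (sub_ne_zero.mpr hne), one_smul]
    rw [h2, sub_self, zero_smul] at h1
    have h3 : t - r0 = 0 := (smul_eq_zero.mp h1.symm).resolve_right hx0
    rw [hr, h2, sub_eq_zero.mp h3]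
  have key2 : ∀ a, y a = r0 • x a := by
    intro a
    by_cases ha : ∀ t : k, x a ≠ t • x c0
    · exact key a ha
    · push Not at ha
      obtain ⟨t, ht⟩ := ha
      have h1 := key (a + c) (by
        intro t' h
        apply hxc (t' - t)
        rw [sub_smul, ← h, ← ht, map_add]
        abel)
      have h2 := key c hxc
      rw [map_add, map_add, h2, smul_add] at h1
      exact add_right_cancel h1
  let N : (ℕ → A) →+ (ℕ → k) := (ia A k).comp M - (DistribSMul.toAddMonoidHom (ℕ → k) r0).comp (ia A k)
  have hN : ∀ a, N a = ia A k (M a) - r0 • ia A k a := fun a => rfl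
  obtain ⟨m, hm⟩ := step_small N (by
    intro j s hs n hn
    rw [hN, Pi.sub_apply, Pi.smul_apply, ia_apply, ia_apply, hM j s hs n hn, hs n hn]
    simp) (U : Set (ℕ → k)) (mk_span_lt s hs) (by
    intro a
    have := key2 a
    rw [hx, hy, ← map_smul, ← sub_eq_zero, ← map_sub, hq] at this
    exact this)
  apply hT
  refine ⟨r0, m, fun s hs => ?_⟩
  have := hm s hs
  rwa [hN, sub_eq_zero] at this

lemma filt_card [Countable A] : #{M : (ℕ → A) →+ (ℕ → A) // Filt M} ≤ 𝔠 := by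
  have hi : Function.Injective (fun (M : {M : (ℕ → A) →+ (ℕ → A) // Filt M}) (t : ℕ × A × ℕ) =>
      M.1 (Pi.single t.1 t.2.1) t.2.2) := by
    rintro ⟨M, hM⟩ ⟨M', hM'⟩ h
    have h : ∀ i a n, M (Pi.single i a) n = M' (Pi.single i a) n := fun i a n =>
      congrFun h (i, a, n)
    apply Subtype.ext
    apply AddMonoidHom.ext
    intro s
    funext n
    let t : ℕ → A := ∑ i ∈ Finset.range (n + 1), Pi.single i (s i)
    have ht : ∀ j < n + 1, (s - t) j = 0 := by
      intro j hj
      simp only [t, Pi.sub_apply, Finset.sum_apply, Pi.single_apply]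
      rw [Finset.sum_ite_eq, if_pos (Finset.mem_range.mpr hj), sub_self]
    have h1 := hM _ _ ht n (Nat.lt_succ_self n)
    have h2 := hM' _ _ ht n (Nat.lt_succ_self n)
    rw [map_sub, Pi.sub_apply, sub_eq_zero] at h1 h2
    simp only
    rw [h1, h2]
    simp only [t, map_sum, Finset.sum_apply, h]
  refine (Cardinal.mk_le_of_injective hi).trans ?_
  rw [← Cardinal.power_def]
  have h1 : #A ≤ ℵ₀ := Cardinal.mk_le_aleph0_iff.mpr inferInstance
  have h2 : #(ℕ × A × ℕ) ≤ ℵ₀ := Cardinal.mk_le_aleph0_iff.mpr inferInstance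
  calc #A ^ #(ℕ × A × ℕ) ≤ ℵ₀ ^ #(ℕ × A × ℕ) := Cardinal.power_le_power_right h1
    _ ≤ ℵ₀ ^ ℵ₀ := Cardinal.power_le_power_left Cardinal.aleph0_ne_zero h2
    _ = 𝔠 := Cardinal.aleph0_power_aleph0

lemma even_proj [Nontrivial A] (hinj : Function.Injective (algebraMap A k)) :
    ∃ M : (ℕ → A) →+ (ℕ → A), Filt M ∧ ¬ Triv k M := by
  refine ⟨⟨⟨fun s n => if n % 2 = 0 then s n else 0, by funext n; simp⟩, ?_⟩, ?_, ?_⟩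
  · intro s t; funext n
    simp only [Pi.add_apply]
    split_ifs <;> simp
  · intro j s hs n hn
    change (if n % 2 = 0 then s n else 0) = 0
    rw [hs n hn]; simp
  · rintro ⟨r, m, h⟩
    have h1 := congrFun (h (Pi.single (2 * m) 1) (by
      intro n hn; rw [Pi.single_eq_of_ne]; omega)) (2 * m)
    have h2 := congrFun (h (Pi.single (2 * m + 1) 1) (by
      intro n hn; rw [Pi.single_eq_of_ne]; omega)) (2 * m + 1)
    rw [ia_apply, Pi.smul_apply, ia_apply] at h1 h2
    simp only [Pi.single_eq_same, map_one, smul_eq_mul, mul_one] at h1 h2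
    rw [← h1] at h2
    have e1 : (if 2 * m % 2 = 0 then (Pi.single (2 * m) 1 : ℕ → A) (2 * m) else 0) = 1 := by
      rw [if_pos (by omega), Pi.single_eq_same]
    have e2 : (if (2 * m + 1) % 2 = 0 then (Pi.single (2 * m + 1) 1 : ℕ → A) (2 * m + 1) else 0) = 0 := by
      rw [if_neg (by omega)]
    have h3 := hinj h2
    change (if (2 * m + 1) % 2 = 0 then (Pi.single (2 * m + 1) 1 : ℕ → A) (2 * m + 1) else 0) =
      (if 2 * m % 2 = 0 then (Pi.single (2 * m) 1 : ℕ → A) (2 * m) else 0) at h3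
    rw [e1, e2] at h3
    exact zero_ne_one h3

theorem exists_f [Countable A] [Countable k] [Nontrivial A]
    (hinj : Function.Injective (algebraMap A k)) :
    ∃ f : (ℕ → k) →ₗ[k] k, (∀ n, f (Pi.single n 1) = 0) ∧ (∀ v, ∃ s : ℕ → A, f (ia A k s) = v) ∧
      ∀ (M : (ℕ → A) →+ (ℕ → A)) (L : k → k), Filt M →
        (∀ s, f (ia A k (M s)) = L (f (ia A k s))) → ∃ r : A, ∀ v, L v = algebraMap A k r * v := by
  let I := {M : {M : (ℕ → A) →+ (ℕ → A) // Filt M} // ¬ Triv k M.1} × k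
  have hI : #I ≤ #(Cardinal.ord 𝔠).ToType := by
    rw [Cardinal.mk_ord_toType]
    rw [Cardinal.mk_prod, Cardinal.lift_id, Cardinal.lift_id]
    have h1 : #{M : {M : (ℕ → A) →+ (ℕ → A) // Filt M} // ¬ Triv k M.1} ≤ 𝔠 :=
      (Cardinal.mk_subtype_le _).trans filt_card
    have h2 : #k ≤ 𝔠 := (Cardinal.mk_le_aleph0_iff.mpr inferInstance).trans
      Cardinal.aleph0_le_continuum
    calc _ ≤ 𝔠 * 𝔠 := mul_le_mul' h1 h2
      _ = 𝔠 := Cardinal.continuum_mul_self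
  obtain ⟨M0, hM0, hM0'⟩ := even_proj (A := A) (k := k) hinj
  have hne : Nonempty I := ⟨(⟨⟨M0, hM0⟩, hM0'⟩, 0)⟩
  obtain ⟨em⟩ := hI
  let g : (Cardinal.ord 𝔠).ToType → I := Function.invFun em
  have hg : Function.Surjective g := Function.invFun_surjective em.injective
  obtain ⟨f, hf0, hf⟩ := transf (k := k) (V := ℕ → k) (J := (Cardinal.ord 𝔠).ToType)
    (fun j => by simpa using Cardinal.mk_Iio_lt j (by simp))
    (Set.range fun n : ℕ => (Pi.single n 1 : ℕ → k))
    ((Cardinal.mk_le_aleph0_iff.mpr (Set.countable_range _)).trans_lt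
      Cardinal.aleph0_lt_continuum)
    (fun j x y => ∃ a, x = ia A k a ∧ y = ia A k ((g j).1.1.1 a)) (fun j => (g j).2) (by
      intro j s hs
      obtain ⟨a, h1, h2⟩ := step_main hinj _ (g j).1.1.2 (g j).1.2 s hs
      exact ⟨_, _, ⟨a, rfl, rfl⟩, h1, h2⟩)
  have hf' : ∀ M : (ℕ → A) →+ (ℕ → A), Filt M → ¬ Triv k M → ∀ v, ∃ a, f (ia A k a) = 0 ∧
      f (ia A k (M a)) = v := by
    intro M h1 h2 v
    obtain ⟨j, hj⟩ := hg (⟨⟨M, h1⟩, h2⟩, v)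
    obtain ⟨x, y, ⟨a, rfl, rfl⟩, h3, h4⟩ := hf j
    rw [hj] at h4
    exact ⟨a, h3, h4⟩
  have hons : ∀ v, ∃ s : ℕ → A, f (ia A k s) = v := by
    intro v
    obtain ⟨a, -, h⟩ := hf' M0 hM0 hM0' v
    exact ⟨_, h⟩
  refine ⟨f, fun n => hf0 _ ⟨n, rfl⟩, hons, ?_⟩
  intro M L hM hL
  by_cases hT : Triv k M
  · obtain ⟨r, m, hr⟩ := hT
    have h1 := congrFun (hr (Pi.single m 1) (fun n hn => Pi.single_eq_of_ne hn.ne _)) m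
    rw [ia_apply, Pi.smul_apply, ia_apply, Pi.single_eq_same, map_one, smul_eq_mul, mul_one] at h1
    refine ⟨M (Pi.single m 1) m, fun v => ?_⟩
    rw [h1]
    obtain ⟨s, rfl⟩ := hons v
    let t : ℕ → A := s - ∑ i ∈ Finset.range m, Pi.single i (s i)
    have ht : ∀ j < m, t j = 0 := by
      intro j hj
      simp only [t, Pi.sub_apply, Finset.sum_apply, Pi.single_apply]
      rw [Finset.sum_ite_eq, if_pos (Finset.mem_range.mpr hj), sub_self]
    have hft : f (ia A k t) = f (ia A k s) := by
      simp only [t, map_sub, map_sum]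
      rw [sub_eq_self]
      apply Finset.sum_eq_zero
      intro i _
      have : ia A k (Pi.single i (s i)) = algebraMap A k (s i) • Pi.single i 1 := by
        funext n
        rw [ia_apply, Pi.smul_apply, smul_eq_mul]
        by_cases hn : n = i
        · subst hn; simp
        · rw [Pi.single_eq_of_ne hn, Pi.single_eq_of_ne hn]; simp
      rw [this, map_smul, hf0 _ ⟨i, rfl⟩, smul_zero]
    rw [← hft, ← hL, hr t ht, map_smul, smul_eq_mul]
  · exfalso
    obtain ⟨a, h1, h2⟩ := hf' M hM hT 0
    obtain ⟨b, h3, h4⟩ := hf' M hM hT 1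
    rw [hL, h1] at h2
    rw [hL, h3] at h4
    rw [h2] at h4
    exact zero_ne_one h4

end PartFourB

section PartFive

variable {Z A k : Type} [CommRing Z] [CommRing A] [Field k] [Algebra A k]

/-- torsion part modulo the diagonal -/
def DD (p : ℕ) (Z : Type) [CommRing Z] : AddSubgroup (ℕ → Z) where
  carrier := {z | ∃ m : ℕ, ∀ n, ∃ y, (p : Z) ^ m * z n = (p : Z) ^ (n + 1) * y}
  zero_mem' := ⟨0, fun n => ⟨0, by simp⟩⟩
  add_mem' := by
    rintro a b ⟨m, hm⟩ ⟨l, hl⟩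
    refine ⟨m + l, fun n => ?_⟩
    obtain ⟨y, hy⟩ := hm n
    obtain ⟨y', hy'⟩ := hl n
    refine ⟨(p : Z) ^ l * y + (p : Z) ^ m * y', ?_⟩
    rw [Pi.add_apply, pow_add]
    linear_combination (p : Z) ^ l * hy + (p : Z) ^ m * hy'
  neg_mem' := by
    rintro a ⟨m, hm⟩
    refine ⟨m, fun n => ?_⟩
    obtain ⟨y, hy⟩ := hm n
    refine ⟨-y, ?_⟩
    rw [Pi.neg_apply]
    linear_combination -hy

/-- the diagonal embedding -/
def sg (p : ℕ) (Z : Type) [CommRing Z] : (ℕ → Z) →+ DD p Z where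
  toFun z := ⟨fun n => (p : Z) ^ (n + 1) * z n, 0, fun n => ⟨z n, by simp⟩⟩
  map_zero' := by apply Subtype.ext; funext n; simp
  map_add' a b := by
    apply Subtype.ext; funext n
    change (p : Z) ^ (n + 1) * (a n + b n) = (p : Z) ^ (n + 1) * a n + (p : Z) ^ (n + 1) * b n
    ring

/-- the shifted diagonal embedding -/
def bg (p : ℕ) (Z : Type) [CommRing Z] : (ℕ → Z) →+ DD p Z where
  toFun z := ⟨fun n => (p : Z) ^ n * z n, 1, fun n => ⟨z n, by ring⟩⟩
  map_zero' := by apply Subtype.ext; funext n; simp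
  map_add' a b := by
    apply Subtype.ext; funext n
    change (p : Z) ^ n * (a n + b n) = (p : Z) ^ n * a n + (p : Z) ^ n * b n
    ring

lemma sg_apply (p : ℕ) (z : ℕ → Z) (n : ℕ) : (sg p Z z).1 n = (p : Z) ^ (n + 1) * z n := rfl

lemma bg_apply (p : ℕ) (z : ℕ → Z) (n : ℕ) : (bg p Z z).1 n = (p : Z) ^ n * z n := rfl

lemma dd_smul (p m : ℕ) (z : DD p Z) (n : ℕ) : (m • z).1 n = (m : Z) * z.1 n := by
  change m • (z.1 n) = _
  rw [nsmul_eq_mul]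

theorem g_one (p : ℕ) (hp0 : ∀ z : Z, (p : Z) * z = 0 → z = 0) (π : Z →+* A)
    (hπs : Function.Surjective π) (hπk : ∀ z, π z = 0 ↔ ∃ y, z = (p : Z) * y)
    (f : (ℕ → k) →ₗ[k] k) (hf0 : ∀ n, f (Pi.single n 1) = 0)
    (hfs : ∀ v, ∃ s : ℕ → A, f (ia A k s) = v)
    (hf : ∀ (M : (ℕ → A) →+ (ℕ → A)) (L : k → k), Filt M →
        (∀ s, f (ia A k (M s)) = L (f (ia A k s))) → ∃ r : A, ∀ v, L v = algebraMap A k r * v) :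
    ∃ (G : Type) (_ : AddCommGroup G), IsPGroup' p G ∧ ∃ j : k →+ G, Function.Injective j ∧
      (∀ x, x ∈ ulm p G ↔ ∃ v, j v = x) ∧
      (∀ r : A, ∃ φ : G →+ G, ∀ v, φ (j v) = j (algebraMap A k r * v)) ∧
      ∀ φ : G →+ G, ∃ r : A, ∀ v, φ (j v) = j (algebraMap A k r * v) := by
  have hp0' : ∀ (m : ℕ) (z z' : Z), (p : Z) ^ m * z = (p : Z) ^ m * z' → z = z' := by
    intro m
    induction m with
    | zero => intro z z' h; simpa using h
    | succ m ih =>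
      intro z z' h
      apply ih
      have : (p : Z) * ((p : Z) ^ m * z - (p : Z) ^ m * z') = 0 := by
        linear_combination h
      exact sub_eq_zero.mp (hp0 _ this)
  have hπp : ∀ z, π ((p : Z) * z) = 0 := fun z => (hπk _).mpr ⟨z, rfl⟩
  have hsinj : ∀ z z', sg p Z z = sg p Z z' → z = z' := by
    intro z z' h
    funext n
    exact hp0' (n + 1) _ _ (congrFun (congrArg Subtype.val h) n)
  let rh : (ℕ → Z) →+ (ℕ → A) := π.toAddMonoidHom.compLeft ℕ
  have hrh : ∀ z n, rh z n = π (z n) := fun z n => rfl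
  let fr : (ℕ → Z) →+ k := f.toAddMonoidHom.comp ((ia A k).comp rh)
  have hfr : ∀ z, fr z = f (ia A k (rh z)) := fun z => rfl
  have hrs : ∀ s, ∃ z, rh z = s := by
    intro s
    choose z hz using fun n => hπs (s n)
    exact ⟨z, funext hz⟩
  have hfrs : Function.Surjective fr := by
    intro v
    obtain ⟨s, rfl⟩ := hfs v
    obtain ⟨z, rfl⟩ := hrs s
    exact ⟨z, rfl⟩
  have hfrp : ∀ (z : ℕ → Z), rh z = 0 → fr z = 0 := by
    intro z hz
    rw [hfr, hz, map_zero, map_zero]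
  have hrp : ∀ (z : ℕ → Z), rh (p • z) = 0 := by
    intro z
    funext n
    rw [hrh, Pi.smul_apply, nsmul_eq_mul, hπp]; rfl
  let Q : AddSubgroup (DD p Z) := fr.ker.map (sg p Z)
  let G := (DD p Z) ⧸ Q
  let mk : DD p Z →+ G := QuotientAddGroup.mk' Q
  have hmks : ∀ g : G, ∃ w, mk w = g := QuotientAddGroup.mk'_surjective Q
  have hmk0 : ∀ w, mk w = 0 ↔ ∃ z, fr z = 0 ∧ sg p Z z = w := fun w =>
    QuotientAddGroup.eq_zero_iff w
  have hsb : ∀ z, p • bg p Z z = sg p Z z := by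
    intro z
    apply Subtype.ext; funext n
    rw [dd_smul, bg_apply, sg_apply]; ring
  have hG : IsPGroup' p G := by
    intro g
    obtain ⟨w, rfl⟩ := hmks g
    obtain ⟨m, hm⟩ := w.2
    choose y hy using hm
    refine ⟨m + 1, ?_⟩
    rw [← map_nsmul, hmk0]
    refine ⟨p • y, hfrp _ (hrp y), ?_⟩
    apply Subtype.ext; funext n
    rw [dd_smul, sg_apply, Pi.smul_apply, nsmul_eq_mul]
    push_cast
    linear_combination -(p : Z) * hy n
  -- the Ulm subgroup
  have hul1 : ∀ w, mk w ∈ ulm p G → ∃ y, sg p Z y = w := by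
    intro w hw
    have : ∀ n, ∃ y, (p : Z) ^ (n + 1) * y = w.1 n := by
      intro n
      obtain ⟨g, hg⟩ := mem_ulm.mp hw (n + 1)
      obtain ⟨u, rfl⟩ := hmks g
      rw [← map_nsmul, ← sub_eq_zero, ← map_sub, hmk0] at hg
      obtain ⟨z, -, hz⟩ := hg
      have h1 := congrFun (congrArg Subtype.val hz) n
      have h2 : ((p ^ (n + 1) • u - w : DD p Z)).1 n = (p ^ (n + 1) • u).1 n - w.1 n := rfl
      rw [h2, dd_smul, sg_apply] at h1
      push_cast at h1
      exact ⟨u.1 n - z n, by linear_combination -h1⟩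
    choose y hy using this
    exact ⟨y, Subtype.ext (funext hy)⟩
  have hul2 : ∀ z, mk (sg p Z z) ∈ ulm p G := by
    intro z
    rw [mem_ulm]
    intro m
    let hd : ℕ → Z := fun n => if n < m then z n else 0
    let tl : ℕ → Z := fun n => if n < m then 0 else (p : Z) ^ (n + 1 - m) * z n
    have htl : tl ∈ DD p Z := by
      refine ⟨m, fun n => ⟨if n < m then 0 else z n, ?_⟩⟩
      simp only [tl]
      split_ifs with h
      · simp
      · rw [← mul_assoc, ← pow_add]; congr 2; omega
    refine ⟨mk ⟨tl, htl⟩, ?_⟩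
    rw [← map_nsmul, ← sub_eq_zero, ← map_sub, hmk0]
    refine ⟨-hd, ?_, ?_⟩
    · rw [map_neg, neg_eq_zero, hfr]
      have : ia A k (rh hd) = ∑ i ∈ Finset.range m, algebraMap A k (π (z i)) • Pi.single i (1 : k) := by
        funext n
        rw [ia_apply, hrh]
        simp only [Finset.sum_apply, Pi.smul_apply, Pi.single_apply, smul_eq_mul, mul_ite, mul_one,
          mul_zero, hd]
        rw [Finset.sum_ite_eq]
        by_cases hn : n < m
        · rw [if_pos hn, if_pos (Finset.mem_range.mpr hn)]
        · rw [if_neg hn, if_neg (by simpa using hn)]; simp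
      rw [this, map_sum]
      apply Finset.sum_eq_zero
      intro i _
      rw [map_smul, hf0, smul_zero]
    · apply Subtype.ext; funext n
      have h2 : ((p ^ m • (⟨tl, htl⟩ : DD p Z) - sg p Z z : DD p Z)).1 n =
        (p ^ m • (⟨tl, htl⟩ : DD p Z)).1 n - (sg p Z z).1 n := rfl
      rw [h2, dd_smul, sg_apply, sg_apply]
      simp only [Pi.neg_apply, hd, tl]
      split_ifs with h
      · simp
      · push_cast
        rw [← mul_assoc, ← pow_add, show m + (n + 1 - m) = n + 1 by omega]
        ring
  -- the map j
  obtain ⟨j, hj⟩ : ∃ j : k →+ G, ∀ z, j (fr z) = mk (sg p Z z) := by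
    refine ⟨fr.liftOfSurjective hfrs ⟨mk.comp (sg p Z), ?_⟩, ?_⟩
    · intro z hz
      exact (hmk0 _).mpr ⟨z, hz, rfl⟩
    · intro z
      exact AddMonoidHom.liftOfRightInverse_comp_apply _ _ _ _ z
  have hjinj : Function.Injective j := by
    rw [injective_iff_map_eq_zero]
    intro v hv
    obtain ⟨z, rfl⟩ := hfrs v
    rw [hj, hmk0] at hv
    obtain ⟨z', h1, h2⟩ := hv
    rw [← hsinj _ _ h2, h1]
  have hjr : ∀ x, x ∈ ulm p G ↔ ∃ v, j v = x := by
    intro x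
    constructor
    · intro hx
      obtain ⟨w, rfl⟩ := hmks x
      obtain ⟨y, rfl⟩ := hul1 w hx
      exact ⟨fr y, hj y⟩
    · rintro ⟨v, rfl⟩
      obtain ⟨z, rfl⟩ := hfrs v
      rw [hj]
      exact hul2 z
  refine ⟨G, inferInstance, hG, j, hjinj, hjr, ?_, ?_⟩
  · intro r
    obtain ⟨z0, rfl⟩ := hπs r
    have hfm : ∀ z : ℕ → Z, fr (fun n => z0 * z n) = algebraMap A k (π z0) * fr z := by
      intro z
      rw [hfr, hfr, ← smul_eq_mul, ← map_smul]
      congr 1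
      funext n
      rw [ia_apply, hrh, Pi.smul_apply, ia_apply, hrh, map_mul, map_mul, smul_eq_mul]
    let μ : DD p Z →+ DD p Z := AddMonoidHom.mk' (fun w => ⟨fun n => z0 * w.1 n, by
        obtain ⟨m, hm⟩ := w.2
        refine ⟨m, fun n => ?_⟩
        obtain ⟨y, hy⟩ := hm n
        exact ⟨z0 * y, by linear_combination z0 * hy⟩⟩) (by
      intro a b
      apply Subtype.ext; funext n
      exact mul_add z0 (a.1 n) (b.1 n))
    have hμ : ∀ z, μ (sg p Z z) = sg p Z (fun n => z0 * z n) := by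
      intro z
      apply Subtype.ext; funext n
      change z0 * ((p : Z) ^ (n + 1) * z n) = (p : Z) ^ (n + 1) * (z0 * z n)
      ring
    have hQ : Q ≤ Q.comap μ := by
      rintro _ ⟨z, hz, rfl⟩
      rw [AddSubgroup.mem_comap, hμ]
      refine ⟨_, ?_, rfl⟩
      have hz' : fr z = 0 := hz
      change fr _ = 0
      rw [hfm, hz', mul_zero]
    refine ⟨QuotientAddGroup.map Q Q μ hQ, fun v => ?_⟩
    obtain ⟨z, rfl⟩ := hfrs v
    rw [← hfm, hj, hj, ← hμ]
    rfl
  intro φ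
  choose L hL using fun v => (hjr (φ (j v))).mp (ulm_map φ ((hjr _).mpr ⟨v, rfl⟩))
  let R : (ℕ → Z) → (ℕ → Z) → Prop := fun z y => ∃ w, mk w = φ (mk (bg p Z z)) ∧ p • w = sg p Z y
  have hRsub : ∀ z y z' y', R z y → R z' y' → R (z - z') (y - y') := by
    rintro z y z' y' ⟨w, h1, h2⟩ ⟨w', h1', h2'⟩
    refine ⟨w - w', ?_, ?_⟩
    · rw [map_sub, h1, h1', map_sub, map_sub, map_sub]
    · rw [smul_sub, h2, h2', map_sub]
  have hRw : ∀ z w, mk w = φ (mk (bg p Z z)) → ∃ y, p • w = sg p Z y := by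
    intro z w hw
    obtain ⟨y, hy⟩ := hul1 (p • w) (by
      rw [map_nsmul, hw, ← map_nsmul, ← map_nsmul, hsb]
      exact ulm_map φ (hul2 z))
    exact ⟨y, hy.symm⟩
  have hRex : ∀ z, ∃ y, R z y := by
    intro z
    obtain ⟨w, hw⟩ := hmks (φ (mk (bg p Z z)))
    obtain ⟨y, hy⟩ := hRw z w hw
    exact ⟨y, w, hw, hy⟩
  have hR0 : ∀ z y, R z y → rh z = 0 → rh y = 0 := by
    rintro z y ⟨w, h1, h2⟩ hz
    have : ∀ n, ∃ y, z n = (p : Z) * y := fun n => (hπk _).mp (congrFun hz n)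
    choose z' hz' using this
    have hb : bg p Z z = sg p Z z' := by
      apply Subtype.ext; funext n
      rw [bg_apply, sg_apply, hz']; ring
    obtain ⟨y1, hy1⟩ := hul1 w (by
      rw [h1, hb]; exact ulm_map φ (hul2 z'))
    rw [← hy1, ← map_nsmul] at h2
    rw [← hsinj _ _ h2]
    exact hrp y1
  have hRj : ∀ z y, R z y → fr y = L (fr z) := by
    rintro z y ⟨w, h1, h2⟩
    apply hjinj
    rw [hL, hj, hj, ← h2, map_nsmul, h1, ← map_nsmul, ← map_nsmul, hsb]
  choose lf hlf using hrs
  choose Y hY using hRex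
  have hM : ∀ z y, R z y → rh (Y (lf (rh z))) = rh y := by
    intro z y h
    have := hR0 _ _ (hRsub _ _ _ _ (hY (lf (rh z))) h) (by rw [map_sub, hlf, sub_self])
    rwa [map_sub, sub_eq_zero] at this
  let M : (ℕ → A) →+ (ℕ → A) := AddMonoidHom.mk' (fun s => rh (Y (lf s))) (by
    intro s t
    have h1 := hRsub _ _ _ _ (hRsub _ _ _ _ (hY (lf (s + t))) (hY (lf s))) (hY (lf t))
    have h2 := hR0 _ _ h1 (by rw [map_sub, map_sub, hlf, hlf, hlf]; abel)
    rw [map_sub, map_sub, sub_sub, sub_eq_zero] at h2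
    exact h2)
  have hMd : ∀ s, M s = rh (Y (lf s)) := fun s => rfl
  obtain ⟨r, hr⟩ := hf M L (by
    intro i s hs n hn
    let z : ℕ → Z := fun n => if n < i then 0 else lf s n
    have hz : rh z = s := by
      funext n
      rw [hrh]
      simp only [z]
      split_ifs with h
      · rw [map_zero, hs n h]
      · exact congrFun (hlf s) n
    let b' : ℕ → Z := fun n => if n < i then 0 else (p : Z) ^ (n - i) * lf s n
    have hb' : b' ∈ DD p Z := by
      refine ⟨i + 1, fun n => ⟨if n < i then 0 else lf s n, ?_⟩⟩
      simp only [b']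
      split_ifs with h
      · simp
      · rw [← mul_assoc, ← pow_add]; congr 2; omega
    have hbb : bg p Z z = p ^ i • (⟨b', hb'⟩ : DD p Z) := by
      apply Subtype.ext; funext n
      rw [bg_apply, dd_smul]
      simp only [z, b']
      push_cast
      split_ifs with h
      · simp
      · rw [← mul_assoc, ← pow_add]; congr 2; omega
    obtain ⟨w', hw'⟩ := hmks (φ (mk ⟨b', hb'⟩))
    have hw : mk (p ^ i • w') = φ (mk (bg p Z z)) := by
      rw [hbb, map_nsmul, map_nsmul, map_nsmul, hw']
    obtain ⟨y, hy⟩ := hRw z _ hw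
    have h1 := hM z y ⟨_, hw, hy⟩
    rw [hz] at h1
    rw [hMd, h1, hrh, hπk]
    have h2 := congrFun (congrArg Subtype.val hy) n
    rw [dd_smul, dd_smul, sg_apply] at h2
    push_cast at h2
    refine ⟨(p : Z) ^ (i - (n + 1)) * w'.1 n, ?_⟩
    apply hp0' (n + 1)
    rw [← h2]
    have : (p : Z) ^ i = (p : Z) ^ (n + 1) * (p : Z) ^ (i - (n + 1)) := by
      rw [← pow_add]; congr 1; omega
    rw [this]; ring) (by
    intro s
    have := hRj _ _ (hY (lf s))
    rw [hfr, hfr, hlf] at this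
    rw [hMd]
    exact this)
  exact ⟨r, fun v => by rw [← hL, hr]⟩

end PartFive

section PartSix

open Polynomial

variable {K : Type} [Field K]

/-- rational functions of degree less than `m` -/
noncomputable def RB (K : Type) [Field K] (m : ℤ) : AddSubgroup (RatFunc K) where
  carrier := {v | v = 0 ∨ v.intDegree < m}
  zero_mem' := Or.inl rfl
  add_mem' := by
    intro a b ha hb
    by_cases hb0 : b = 0
    · rw [hb0, add_zero]; exact ha
    by_cases ha0 : a = 0
    · rw [ha0, zero_add]; exact hb
    by_cases hab : a + b = 0
    · exact Or.inl hab
    · have h1 := ha.resolve_left ha0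
      have h2 := hb.resolve_left hb0
      exact Or.inr ((RatFunc.intDegree_add_le hb0 hab).trans_lt (max_lt h1 h2))
  neg_mem' := by
    intro a ha
    rcases ha with h | h
    · exact Or.inl (by rw [h, neg_zero])
    · exact Or.inr (by rw [RatFunc.intDegree_neg]; exact h)

lemma mem_RB {m : ℤ} {v : RatFunc K} : v ∈ RB K m ↔ v = 0 ∨ v.intDegree < m := Iff.rfl

lemma RB_mono {m l : ℤ} (h : m ≤ l) : RB K m ≤ RB K l := by
  intro v hv
  rcases hv with hv | hv
  · exact Or.inl hv
  · exact Or.inr (hv.trans_le h)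

lemma RB_mul (r : K[X]) {v : RatFunc K} (hv : v ∈ RB K 0) :
    algebraMap K[X] (RatFunc K) r * v ∈ RB K r.natDegree := by
  by_cases h0 : algebraMap K[X] (RatFunc K) r = 0
  · exact Or.inl (by rw [h0, zero_mul])
  rcases hv with hv | hv
  · exact Or.inl (by rw [hv, mul_zero])
  · by_cases hv0 : v = 0
    · exact Or.inl (by rw [hv0, mul_zero])
    refine Or.inr ?_
    rw [RatFunc.intDegree_mul h0 hv0, RatFunc.intDegree_polynomial]
    omega

lemma RB_split (r : K[X]) {v : RatFunc K} (hv : v ∈ RB K 0) :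
    ∃ q ∈ degreeLT K r.natDegree, ∃ u ∈ RB K 0,
      algebraMap K[X] (RatFunc K) r * v = u + algebraMap K[X] (RatFunc K) q := by
  have hd : v.denom ≠ 0 := v.denom_ne_zero
  have hd' : algebraMap K[X] (RatFunc K) v.denom ≠ 0 := by
    simpa using hd
  have hdiv := EuclideanDomain.div_add_mod (r * v.num) v.denom
  let q := (r * v.num) / v.denom
  let m := (r * v.num) % v.denom
  have hm : algebraMap K[X] (RatFunc K) m / algebraMap K[X] (RatFunc K) v.denom ∈ RB K 0 := by
    by_cases hm0 : m = 0
    · exact Or.inl (by rw [hm0, map_zero, zero_div])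
    · right
      have hm0' : algebraMap K[X] (RatFunc K) m ≠ 0 := by simpa using hm0
      rw [RatFunc.intDegree_div hm0' hd', RatFunc.intDegree_polynomial,
        RatFunc.intDegree_polynomial]
      have := Polynomial.natDegree_lt_natDegree hm0 (EuclideanDomain.mod_lt (r * v.num) hd)
      omega
  have he : algebraMap K[X] (RatFunc K) r * v =
      algebraMap K[X] (RatFunc K) m / algebraMap K[X] (RatFunc K) v.denom
        + algebraMap K[X] (RatFunc K) q := by
    have h1 : algebraMap K[X] (RatFunc K) v.denom * algebraMap K[X] (RatFunc K) q
        + algebraMap K[X] (RatFunc K) m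
        = algebraMap K[X] (RatFunc K) r * algebraMap K[X] (RatFunc K) v.num := by
      rw [← map_mul, ← map_add, ← map_mul]
      exact congrArg _ hdiv
    nth_rw 1 [← RatFunc.num_div_denom v]
    field_simp
    linear_combination -h1
  refine ⟨q, ?_, _, hm, he⟩
  have hq : algebraMap K[X] (RatFunc K) q ∈ RB K r.natDegree := by
    have : algebraMap K[X] (RatFunc K) q = algebraMap K[X] (RatFunc K) r * v -
      algebraMap K[X] (RatFunc K) m / algebraMap K[X] (RatFunc K) v.denom := by
      rw [he]; ring
    rw [this]
    exact sub_mem (RB_mul r hv) (RB_mono (by omega) hm)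
  rw [mem_degreeLT]
  rcases hq with hq | hq
  · have : q = 0 := by simpa using hq
    rw [this, degree_zero]
    exact WithBot.bot_lt_coe _
  · rw [RatFunc.intDegree_polynomial] at hq
    exact degree_le_natDegree.trans_lt (by exact_mod_cast hq)

theorem main_aux (p : ℕ) (hp : p.Prime) : ∃ (G : Type) (_ : AddCommGroup G), IsPGroup' p G ∧
      (∀ x ∈ ⨅ n : ℕ, (pPowSub p n : AddSubgroup G), p • x = 0) ∧
      (⨅ n : ℕ, (pPowSub p n : AddSubgroup G)) ≠ ⊥ ∧
      MinCharInertia G ∧ ¬ MinFullInertia G := by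
  have : Fact p.Prime := ⟨hp⟩
  have hcA : Countable (ZMod p)[X] := by
    have : Function.Injective (fun q : (ZMod p)[X] => q.toFinsupp.coeff) := by
      intro a b h
      apply Polynomial.ext
      intro n
      exact DFunLike.congr_fun h n
    exact this.countable
  have hck : Countable (RatFunc (ZMod p)) := by
    have : Function.Injective (fun q : RatFunc (ZMod p) => (q.num, q.denom)) := by
      intro a b h
      rw [← RatFunc.num_div_denom a, ← RatFunc.num_div_denom b]
      rw [show a.num = b.num from (Prod.ext_iff.mp h).1, show a.denom = b.denom from (Prod.ext_iff.mp h).2]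
    exact this.countable
  have hinj : Function.Injective (algebraMap (ZMod p)[X] (RatFunc (ZMod p))) :=
    RatFunc.algebraMap_injective _
  obtain ⟨f, hf0, hfs, hf⟩ := exists_f hinj
  obtain ⟨G, _, hG, j, hj, hjr, hj1, hj2⟩ := g_one (Z := ℤ[X]) (A := (ZMod p)[X])
    (k := RatFunc (ZMod p)) p
    (by
      intro z hz
      have : (p : ℤ[X]) ≠ 0 := by exact_mod_cast hp.ne_zero
      exact (mul_eq_zero.mp hz).resolve_left this)
    (mapRingHom (Int.castRingHom (ZMod p)))
    (map_surjective _ (ZMod.ringHom_surjective _))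
    (by
      intro z
      have hC : (p : ℤ[X]) = C (p : ℤ) := by simp
      rw [hC]
      change _ ↔ C (p : ℤ) ∣ z
      rw [C_dvd_iff_dvd_coeff, Polynomial.ext_iff]
      refine forall_congr' fun n => ?_
      rw [coe_mapRingHom, coeff_map, coeff_zero, eq_intCast, ZMod.intCast_zmod_eq_zero_iff_dvd]) f hf0 hfs hf
  have hnat : ∀ (c : ℕ) (v : RatFunc (ZMod p)), c • j v = j ((c : RatFunc (ZMod p)) * v) := by
    intro c v
    rw [← map_nsmul, nsmul_eq_mul]
  refine struct_main p hp G hG ?_ ?_ ?_ ((RB (ZMod p) 0).map j) ?_ ?_ ?_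
  · intro v hv
    obtain ⟨u, rfl⟩ := (hjr _).mp hv
    rw [hnat]
    have : (p : RatFunc (ZMod p)) = 0 := by
      have := congrArg (algebraMap (ZMod p) (RatFunc (ZMod p))) (CharP.cast_eq_zero (ZMod p) p)
      simpa using this
    rw [this, zero_mul, map_zero]
  · intro h
    have h1 : j 1 ∈ ulm p G := (hjr _).mpr ⟨1, rfl⟩
    rw [h, AddSubgroup.mem_bot, ← map_zero j] at h1
    exact one_ne_zero (hj h1)
  · intro a a' h
    obtain ⟨r, hr⟩ := hj2 a
    obtain ⟨r', hr'⟩ := hj2 a'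
    have h1 := h (j 1) ((hjr _).mpr ⟨1, rfl⟩)
    rw [hr', hr, mul_one] at h1
    have h2 := hj h1
    rw [← map_mul, ← map_one (algebraMap (ZMod p)[X] (RatFunc (ZMod p)))] at h2
    have h3 : IsUnit r := IsUnit.of_mul_eq_one _ (hinj h2)
    obtain ⟨c, -, hc⟩ := Polynomial.isUnit_iff.mp h3
    refine ⟨(c.val : ℤ), ?_⟩
    intro v hv
    obtain ⟨u, rfl⟩ := (hjr _).mp hv
    rw [hr, natCast_zsmul, hnat, ← hc]
    congr 2
    have : C c = ((c.val : ℕ) : (ZMod p)[X]) := by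
      rw [← Polynomial.C_eq_natCast, ZMod.natCast_zmod_val]
    rw [this, map_natCast]
  · rintro _ ⟨u, -, rfl⟩
    exact (hjr _).mpr ⟨u, rfl⟩
  · intro a
    obtain ⟨r, hr⟩ := hj2 a
    have hfin : Finite (degreeLT (ZMod p) r.natDegree).toAddSubgroup :=
      Finite.of_equiv _ (degreeLTEquiv (ZMod p) r.natDegree).symm.toEquiv
    refine ⟨(degreeLT (ZMod p) r.natDegree).toAddSubgroup.map
      (j.comp (algebraMap (ZMod p)[X] (RatFunc (ZMod p))).toAddMonoidHom),
      finite_map_aux _ _ hfin, ?_⟩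
    rintro _ ⟨_, ⟨v, hv, rfl⟩, rfl⟩
    obtain ⟨q, hq, u, hu, he⟩ := RB_split r hv
    rw [hr, he, map_add]
    exact AddSubgroup.add_mem_sup ⟨u, hu, rfl⟩ ⟨q, hq, rfl⟩
  · intro Y hYV hY hXY hYX
    have hX1 : algebraMap (ZMod p)[X] (RatFunc (ZMod p)) X = RatFunc.X := RatFunc.algebraMap_X
    have hX0 : (RatFunc.X : RatFunc (ZMod p)) ≠ 0 := RatFunc.X_ne_zero
    have hpow : ∀ n : ℕ, ((RatFunc.X : RatFunc (ZMod p)) ^ n).intDegree = n := by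
      intro n
      rw [← hX1, ← map_pow, RatFunc.intDegree_polynomial, natDegree_X_pow]
    by_cases hYb : Y = ⊥
    · obtain ⟨F, hF, hXF⟩ := hXY
      rw [hYb, bot_sup_eq] at hXF
      have hmem : ∀ n : ℕ, j ((RatFunc.X ^ (n + 1))⁻¹) ∈ F := by
        intro n
        refine hXF ⟨_, Or.inr ?_, rfl⟩
        rw [RatFunc.intDegree_inv, hpow]
        push_cast; omega
      have hin : Function.Injective (fun n : ℕ => (⟨_, hmem n⟩ : F)) := by
        intro n m h
        have h1 := congrArg RatFunc.intDegree (hj (congrArg Subtype.val h))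
        rw [RatFunc.intDegree_inv, RatFunc.intDegree_inv, hpow, hpow] at h1
        push_cast at h1; omega
      exact not_injective_infinite_finite _ hin
    · obtain ⟨⟨y, hy⟩, hy1⟩ := AddSubgroup.ne_bot_iff_exists_ne_zero.mp hYb
      have hy0 : y ≠ 0 := fun h => hy1 (Subtype.ext h)
      obtain ⟨v, rfl⟩ := (hjr _).mp (hYV hy)
      have hv0 : v ≠ 0 := by
        rintro rfl
        exact hy0 (map_zero j)
      let t := v.intDegree.natAbs
      have hdeg : ∀ i : ℕ, (RatFunc.X ^ (i + t) * v).intDegree = i + t + v.intDegree := by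
        intro i
        rw [RatFunc.intDegree_mul (pow_ne_zero _ hX0) hv0, hpow]
        push_cast; ring
      refine hYX.greedy (fun i => j (RatFunc.X ^ (i + t) * v)) ?_
        (fun i => (RB (ZMod p) (i + t + v.intDegree)).map j) ?_ ?_
      · intro i
        obtain ⟨φ, hφ⟩ := hj1 (X ^ (i + t))
        have := hφ v
        rw [map_pow, hX1] at this
        rw [← this]
        exact hY φ ⟨_, hy, rfl⟩
      · intro i l hil
        refine ⟨_, Or.inr ?_, rfl⟩
        rw [hdeg]; omega
      · intro i hi
        have h1 : (RB (ZMod p) 0).map j ≤ (RB (ZMod p) (i + t + v.intDegree)).map j :=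
          AddSubgroup.map_mono (RB_mono (by omega))
        rw [sup_eq_right.mpr h1] at hi
        obtain ⟨u, hu, he⟩ := hi
        rw [hj he] at hu
        rcases hu with hu | hu
        · exact mul_ne_zero (pow_ne_zero _ hX0) hv0 hu
        · rw [hdeg] at hu; omega

end PartSix

/-- Example 3.2: for every prime `p` there is a `p`-group `G` of length `ω + 1` (i.e. with
`p • p^ωG = 0` and `p^ωG ≠ 0`) having minimal characteristic inertia but not minimal full
inertia. -/
theorem stmt_17 (p : ℕ) (hp : p.Prime) :
    ∃ (G : Type) (_ : AddCommGroup G), IsPGroup' p G ∧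
      (∀ x ∈ ⨅ n : ℕ, (pPowSub p n : AddSubgroup G), p • x = 0) ∧
      (⨅ n : ℕ, (pPowSub p n : AddSubgroup G)) ≠ ⊥ ∧
      MinCharInertia G ∧ ¬ MinFullInertia G := by
  exact main_aux p hp
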